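/- arXiv:0812.1304 — 2 statements merged into one kernel-verified Lean document; each statement's English description precedes it below -/
import Mathlib

section
/- Let R be a commutative ring with finite Gorenstein global dimension. The following assertions are equivalent: (1) every submodule of a projective R-module is Gorenstein projective (i.e., R is G-hereditary); (2) Gpd_R(M) ≤ 1 for all finitely generated R-modules M; (3) every ideal of R is Gorenstein projective; (4) id_R(P) ≤ 1 for all R-modules P with finite projective dimension; (5) id_R(P') ≤ 1 for all projective R-modules P'; (6) pd_R(E) ≤ 1 for all R-modules E with finite injective dimension; (7) pd_R(E') ≤ 1 for all injective R-modules E'. -/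
noncomputable section

universe u

variable (R : Type u) [CommRing R]

/-- `IsShortExact R f g` says that `0 → A → B → C → 0` is a short exact sequence. -/
def IsShortExact {A B C : Type u} [AddCommGroup A] [Module R A] [AddCommGroup B] [Module R B]
    [AddCommGroup C] [Module R C] (f : A →ₗ[R] B) (g : B →ₗ[R] C) : Prop :=
  Function.Injective f ∧ Function.Surjective g ∧ LinearMap.range f = LinearMap.ker g

/-- A module `M` is Gorenstein projective if there is a complete projective resolution
`⋯ → P i → P (i+1) → ⋯` (an exact sequence of projective modules which remains exact after
applying `Hom(-, Q)` for every projective module `Q`) with `M ≅ Im (P 0 → P 1)`. -/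
def IsGorensteinProjective (M : Type u) [AddCommGroup M] [Module R M] : Prop :=
  ∃ (P : ℤ → Type u) (_ : ∀ i, AddCommGroup (P i)) (_ : ∀ i, Module R (P i))
    (d : ∀ i, P i →ₗ[R] P (i + 1)),
    (∀ i, Module.Projective R (P i)) ∧
    (∀ i, LinearMap.range (d i) = LinearMap.ker (d (i + 1))) ∧
    Nonempty (M ≃ₗ[R] LinearMap.range (d 0)) ∧
    (∀ (Q : Type u) (_ : AddCommGroup Q) (_ : Module R Q), Module.Projective R Q →
      ∀ (i : ℤ) (g : P (i + 1) →ₗ[R] Q), g.comp (d i) = 0 →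
        ∃ h : P (i + 1 + 1) →ₗ[R] Q, h.comp (d (i + 1)) = g)

/-- A module `M` is strongly Gorenstein projective if there is a complete projective
resolution of the form `⋯ → P →f P →f P → ⋯` with `M ≅ Im f`. -/
def IsStronglyGorensteinProjective (M : Type u) [AddCommGroup M] [Module R M] : Prop :=
  ∃ (P : Type u) (_ : AddCommGroup P) (_ : Module R P) (f : P →ₗ[R] P),
    Module.Projective R P ∧
    LinearMap.range f = LinearMap.ker f ∧
    Nonempty (M ≃ₗ[R] LinearMap.range f) ∧
    (∀ (Q : Type u) (_ : AddCommGroup Q) (_ : Module R Q), Module.Projective R Q →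
      ∀ g : P →ₗ[R] Q, g.comp f = 0 → ∃ h : P →ₗ[R] Q, h.comp f = g)

/-- A module `M` is Gorenstein flat if there is an exact sequence of flat modules
`⋯ → F i → F (i+1) → ⋯` which remains exact after applying `- ⊗ I` for every injective
module `I`, with `M ≅ Im (F 0 → F 1)`. -/
def IsGorensteinFlat (M : Type u) [AddCommGroup M] [Module R M] : Prop :=
  ∃ (F : ℤ → Type u) (_ : ∀ i, AddCommGroup (F i)) (_ : ∀ i, Module R (F i))
    (d : ∀ i, F i →ₗ[R] F (i + 1)),
    (∀ i, Module.Flat R (F i)) ∧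
    (∀ i, LinearMap.range (d i) = LinearMap.ker (d (i + 1))) ∧
    Nonempty (M ≃ₗ[R] LinearMap.range (d 0)) ∧
    (∀ (I : Type u) (_ : AddCommGroup I) (_ : Module R I), Module.Injective R I →
      ∀ i : ℤ, LinearMap.range (LinearMap.rTensor I (d i)) =
        LinearMap.ker (LinearMap.rTensor I (d (i + 1))))

/-- A module `M` is strongly Gorenstein flat if there is an exact sequence of flat modules
of the form `⋯ → F →f F →f F → ⋯` which remains exact after applying `- ⊗ I` for every
injective module `I`, with `M ≅ Im f`. -/
def IsStronglyGorensteinFlat (M : Type u) [AddCommGroup M] [Module R M] : Prop :=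
  ∃ (F : Type u) (_ : AddCommGroup F) (_ : Module R F) (f : F →ₗ[R] F),
    Module.Flat R F ∧
    LinearMap.range f = LinearMap.ker f ∧
    Nonempty (M ≃ₗ[R] LinearMap.range f) ∧
    (∀ (I : Type u) (_ : AddCommGroup I) (_ : Module R I), Module.Injective R I →
      LinearMap.range (LinearMap.rTensor I f) = LinearMap.ker (LinearMap.rTensor I f))

/-- `ProjDimLE R M n` : the projective dimension of `M` is at most `n`, i.e. there is an exact
sequence `0 → P n → ⋯ → P 0 → M → 0` with each `P i` projective. -/
def ProjDimLE (M : Type u) [AddCommGroup M] [Module R M] (n : ℕ) : Prop :=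
  ∃ (P : ℕ → Type u) (_ : ∀ i, AddCommGroup (P i)) (_ : ∀ i, Module R (P i))
    (d : ∀ i, P (i + 1) →ₗ[R] P i) (ε : P 0 →ₗ[R] M),
    (∀ i, Module.Projective R (P i)) ∧
    (∀ i, n < i → Subsingleton (P i)) ∧
    Function.Surjective ε ∧
    LinearMap.ker ε = LinearMap.range (d 0) ∧
    (∀ i, LinearMap.ker (d i) = LinearMap.range (d (i + 1)))

/-- `InjDimLE R M n` : the injective dimension of `M` is at most `n`, i.e. there is an exact
sequence `0 → M → E 0 → ⋯ → E n → 0` with each `E i` injective. -/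
def InjDimLE (M : Type u) [AddCommGroup M] [Module R M] (n : ℕ) : Prop :=
  ∃ (E : ℕ → Type u) (_ : ∀ i, AddCommGroup (E i)) (_ : ∀ i, Module R (E i))
    (d : ∀ i, E i →ₗ[R] E (i + 1)) (η : M →ₗ[R] E 0),
    (∀ i, Module.Injective R (E i)) ∧
    (∀ i, n < i → Subsingleton (E i)) ∧
    Function.Injective η ∧
    LinearMap.range η = LinearMap.ker (d 0) ∧
    (∀ i, LinearMap.range (d i) = LinearMap.ker (d (i + 1)))

/-- `FlatDimLE R M n` : the flat dimension of `M` is at most `n`. -/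
def FlatDimLE (M : Type u) [AddCommGroup M] [Module R M] (n : ℕ) : Prop :=
  ∃ (F : ℕ → Type u) (_ : ∀ i, AddCommGroup (F i)) (_ : ∀ i, Module R (F i))
    (d : ∀ i, F (i + 1) →ₗ[R] F i) (ε : F 0 →ₗ[R] M),
    (∀ i, Module.Flat R (F i)) ∧
    (∀ i, n < i → Subsingleton (F i)) ∧
    Function.Surjective ε ∧
    LinearMap.ker ε = LinearMap.range (d 0) ∧
    (∀ i, LinearMap.ker (d i) = LinearMap.range (d (i + 1)))

/-- `GProjDimLE R M n` : the Gorenstein projective dimension of `M` is at most `n`, i.e.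
there is an exact sequence `0 → G n → ⋯ → G 0 → M → 0` with each `G i` Gorenstein
projective. -/
def GProjDimLE (M : Type u) [AddCommGroup M] [Module R M] (n : ℕ) : Prop :=
  ∃ (G : ℕ → Type u) (_ : ∀ i, AddCommGroup (G i)) (_ : ∀ i, Module R (G i))
    (d : ∀ i, G (i + 1) →ₗ[R] G i) (ε : G 0 →ₗ[R] M),
    (∀ i, IsGorensteinProjective R (G i)) ∧
    (∀ i, n < i → Subsingleton (G i)) ∧
    Function.Surjective ε ∧
    LinearMap.ker ε = LinearMap.range (d 0) ∧
    (∀ i, LinearMap.ker (d i) = LinearMap.range (d (i + 1)))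

/-- `GFlatDimLE R M n` : the Gorenstein flat dimension of `M` is at most `n`. -/
def GFlatDimLE (M : Type u) [AddCommGroup M] [Module R M] (n : ℕ) : Prop :=
  ∃ (G : ℕ → Type u) (_ : ∀ i, AddCommGroup (G i)) (_ : ∀ i, Module R (G i))
    (d : ∀ i, G (i + 1) →ₗ[R] G i) (ε : G 0 →ₗ[R] M),
    (∀ i, IsGorensteinFlat R (G i)) ∧
    (∀ i, n < i → Subsingleton (G i)) ∧
    Function.Surjective ε ∧
    LinearMap.ker ε = LinearMap.range (d 0) ∧
    (∀ i, LinearMap.ker (d i) = LinearMap.range (d (i + 1)))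

/-- A module is finitely presented if it is the quotient of a finite free module by a
finitely generated submodule of relations. -/
def IsFinitelyPresented (M : Type u) [AddCommGroup M] [Module R M] : Prop :=
  ∃ (n : ℕ) (f : (Fin n → R) →ₗ[R] M), Function.Surjective f ∧ (LinearMap.ker f).FG

/-- A ring is coherent if every finitely generated ideal is finitely presented. -/
def IsCoherentRing : Prop :=
  ∀ I : Ideal R, I.FG → IsFinitelyPresented R I

/-- `ExtVanishes R M N i` : `Ext_R^i(M, N) = 0`. -/
def ExtVanishes (M N : Type u) [AddCommGroup M] [Module R M] [AddCommGroup N] [Module R N]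
    (i : ℕ) : Prop :=
  Subsingleton (((Ext R (ModuleCat.{u} R) i).obj
    (Opposite.op (ModuleCat.of R M))).obj (ModuleCat.of R N))

/-- A ring is hereditary if every submodule of a projective module is projective. -/
def IsHereditaryRing : Prop :=
  ∀ (P : Type u) (_ : AddCommGroup P) (_ : Module R P), Module.Projective R P →
    ∀ N : Submodule R P, Module.Projective R N

/-- A ring is semihereditary if every finitely generated ideal is projective. -/
def IsSemihereditaryRing : Prop :=
  ∀ I : Ideal R, I.FG → Module.Projective R I

/-- A ring is Gorenstein hereditary if every submodule of a projective module is
Gorenstein projective. -/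
def IsGHereditaryRing : Prop :=
  ∀ (P : Type u) (_ : AddCommGroup P) (_ : Module R P), Module.Projective R P →
    ∀ N : Submodule R P, IsGorensteinProjective R N

/-- A ring is strongly Gorenstein hereditary if every submodule of a projective module is
strongly Gorenstein projective. -/
def IsSGHereditaryRing : Prop :=
  ∀ (P : Type u) (_ : AddCommGroup P) (_ : Module R P), Module.Projective R P →
    ∀ N : Submodule R P, IsStronglyGorensteinProjective R N

/-- A ring is Gorenstein semihereditary if it is coherent and every submodule of a flat
module is Gorenstein flat. -/
def IsGSemihereditaryRing : Prop :=
  IsCoherentRing R ∧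
    ∀ (F : Type u) (_ : AddCommGroup F) (_ : Module R F), Module.Flat R F →
      ∀ N : Submodule R F, IsGorensteinFlat R N

/-- A ring is strongly Gorenstein semihereditary if it is coherent and every submodule of a
flat module is strongly Gorenstein flat. -/
def IsSGSemihereditaryRing : Prop :=
  IsCoherentRing R ∧
    ∀ (F : Type u) (_ : AddCommGroup F) (_ : Module R F), Module.Flat R F →
      ∀ N : Submodule R F, IsStronglyGorensteinFlat R N

section Auxiliary

variable {R}

namespace IsShortExact

variable {A B C D H G : Type u} [AddCommGroup A] [Module R A] [AddCommGroup B] [Module R B]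
  [AddCommGroup C] [Module R C] [AddCommGroup D] [Module R D] [AddCommGroup H] [Module R H]
  [AddCommGroup G] [Module R G]

lemma apply_apply {f : A →ₗ[R] B} {g : B →ₗ[R] C} (h : IsShortExact R f g) (a : A) :
    g (f a) = 0 := by
  have : f a ∈ LinearMap.ker g := h.2.2 ▸ LinearMap.mem_range_self f a
  exact this

lemma exists_of_apply_eq_zero {f : A →ₗ[R] B} {g : B →ₗ[R] C} (h : IsShortExact R f g) {b : B}
    (hb : g b = 0) : ∃ a, f a = b := by
  have : b ∈ LinearMap.range f := h.2.2 ▸ LinearMap.mem_ker.2 hb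
  exact this

lemma of_forall {f : A →ₗ[R] B} {g : B →ₗ[R] C} (hf : Function.Injective f)
    (hg : Function.Surjective g) (h : ∀ a, g (f a) = 0) (h' : ∀ b, g b = 0 → ∃ a, f a = b) :
    IsShortExact R f g := by
  refine ⟨hf, hg, le_antisymm ?_ fun b hb ↦ h' b hb⟩
  rintro _ ⟨a, rfl⟩
  exact h a

lemma id_zero : IsShortExact R (LinearMap.id : A →ₗ[R] A) (0 : A →ₗ[R] PUnit.{u + 1}) :=
  .of_forall Function.injective_id (Function.surjective_to_subsingleton _) (fun _ ↦ rfl)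
    fun b _ ↦ ⟨b, rfl⟩

lemma zero_id : IsShortExact R (0 : PUnit.{u + 1} →ₗ[R] A) LinearMap.id :=
  .of_forall (Function.injective_of_subsingleton _) Function.surjective_id (fun _ ↦ rfl)
    fun _ hb ↦ ⟨0, hb.symm⟩

lemma ker_subtype {g : B →ₗ[R] C} (hg : Function.Surjective g) :
    IsShortExact R (LinearMap.ker g).subtype g :=
  ⟨Subtype.val_injective, hg, Submodule.range_subtype _⟩

lemma mkQ_range {f : A →ₗ[R] B} (hf : Function.Injective f) :
    IsShortExact R f (LinearMap.range f).mkQ :=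
  ⟨hf, Submodule.mkQ_surjective _, (Submodule.ker_mkQ _).symm⟩

lemma subtype_mkQ (N : Submodule R B) : IsShortExact R N.subtype N.mkQ :=
  ⟨Subtype.val_injective, Submodule.mkQ_surjective _, by simp⟩

/-- A linear map killing the sub of a short exact sequence factors through the quotient. -/
lemma exists_desc {f : A →ₗ[R] B} {g : B →ₗ[R] C} (h : IsShortExact R f g) (k : B →ₗ[R] D)
    (hk : ∀ a, k (f a) = 0) : ∃ l : C →ₗ[R] D, ∀ b, l (g b) = k b := by
  have hle : LinearMap.ker g ≤ LinearMap.ker k := fun b hb ↦ by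
    obtain ⟨a, rfl⟩ := h.exists_of_apply_eq_zero hb
    exact hk a
  refine ⟨((LinearMap.ker g).liftQ k hle).comp
    (g.quotKerEquivOfSurjective h.2.1).symm.toLinearMap, fun b ↦ ?_⟩
  have : (g.quotKerEquivOfSurjective h.2.1).symm (g b) = (LinearMap.ker g).mkQ b := by
    rw [LinearEquiv.symm_apply_eq]
    rfl
  simp [this]

/-- The pushout of two monomorphisms with the same source. -/
lemma exists_pushout {a : A →ₗ[R] G} {e : G →ₗ[R] C} (hG : IsShortExact R a e)
    {h : A →ₗ[R] H} {q : H →ₗ[R] D} (hH : IsShortExact R h q) :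
    ∃ (X : ModuleCat.{u} R) (i : H →ₗ[R] X) (r : X →ₗ[R] C) (j : G →ₗ[R] X) (s : X →ₗ[R] D),
      IsShortExact R i r ∧ IsShortExact R j s := by
  have hinj : Function.Injective (a.prod (-h)) := fun x y hxy ↦ hG.1 (congrArg Prod.fst hxy)
  have hS := mkQ_range hinj
  set π := (LinearMap.range (a.prod (-h))).mkQ
  obtain ⟨r, hr⟩ := hS.exists_desc (e.comp (LinearMap.fst R G H)) (by simp [hG.apply_apply])
  obtain ⟨s, hs⟩ := hS.exists_desc (q.comp (LinearMap.snd R G H)) (by simp [hH.apply_apply])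
  simp only [LinearMap.coe_comp, Function.comp_apply, LinearMap.fst_apply,
    LinearMap.snd_apply] at hr hs
  refine ⟨ModuleCat.of R ((G × H) ⧸ LinearMap.range (a.prod (-h))),
    π.comp (LinearMap.inr R G H), r, π.comp (LinearMap.inl R G H), s, of_forall ?_ ?_ ?_ ?_,
    of_forall ?_ ?_ ?_ ?_⟩
  · refine (injective_iff_map_eq_zero _).2 fun y hy ↦ ?_
    obtain ⟨x, hx⟩ := hS.exists_of_apply_eq_zero hy
    have hx₁ : a x = 0 := congrArg Prod.fst hx
    have hx₂ : -h x = y := congrArg Prod.snd hx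
    rw [← hx₂, hG.1 (hx₁.trans (map_zero a).symm), map_zero, neg_zero]
  · intro c
    obtain ⟨g, rfl⟩ := hG.2.1 c
    exact ⟨π (g, 0), hr _⟩
  · intro y
    simpa using hr (0, y)
  · intro x hx
    obtain ⟨⟨g, y⟩, rfl⟩ := hS.2.1 x
    obtain ⟨z, rfl⟩ := hG.exists_of_apply_eq_zero ((hr _).symm.trans hx)
    refine ⟨y + h z, sub_eq_zero.1 ?_⟩
    have := hS.apply_apply (-z)
    simpa [← map_sub] using this
  · refine (injective_iff_map_eq_zero _).2 fun y hy ↦ ?_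
    obtain ⟨x, hx⟩ := hS.exists_of_apply_eq_zero hy
    have hx₁ : a x = y := congrArg Prod.fst hx
    have hx₂ : -h x = 0 := congrArg Prod.snd hx
    rw [← hx₁, hH.1 ((neg_eq_zero.1 hx₂).trans (map_zero h).symm), map_zero]
  · intro c
    obtain ⟨g, rfl⟩ := hH.2.1 c
    exact ⟨π (0, g), hs _⟩
  · intro y
    simpa using hs (y, 0)
  · intro x hx
    obtain ⟨⟨g, y⟩, rfl⟩ := hS.2.1 x
    obtain ⟨z, rfl⟩ := hH.exists_of_apply_eq_zero ((hs _).symm.trans hx)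
    refine ⟨g + a z, sub_eq_zero.1 ?_⟩
    have := hS.apply_apply z
    simpa [← map_sub] using this

/-- The short exact sequence of cokernels of a composite of two monomorphisms. -/
lemma exists_coker_comp {i : A →ₗ[R] B} {r : B →ₗ[R] C} (hB : IsShortExact R i r)
    {f : B →ₗ[R] G} {g : G →ₗ[R] D} (hG : IsShortExact R f g) :
    ∃ (Y : ModuleCat.{u} R) (a : C →ₗ[R] Y) (b : Y →ₗ[R] D) (p : G →ₗ[R] Y),
      IsShortExact R a b ∧ IsShortExact R (f.comp i) p := by
  have hS := mkQ_range (f := f.comp i) (hG.1.comp hB.1)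
  set π := (LinearMap.range (f.comp i)).mkQ
  obtain ⟨a, ha⟩ := hB.exists_desc (π.comp f) hS.apply_apply
  obtain ⟨b, hb⟩ := hS.exists_desc g (fun x ↦ hG.apply_apply _)
  simp only [LinearMap.coe_comp, Function.comp_apply] at ha
  refine ⟨ModuleCat.of R (G ⧸ LinearMap.range (f.comp i)), a, b, π, of_forall ?_ ?_ ?_ ?_, hS⟩
  · refine (injective_iff_map_eq_zero _).2 fun y hy ↦ ?_
    obtain ⟨y, rfl⟩ := hB.2.1 y
    obtain ⟨x, hx⟩ := hS.exists_of_apply_eq_zero ((ha _).symm.trans hy)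
    rw [← hG.1 hx, hB.apply_apply]
  · intro d
    obtain ⟨g, rfl⟩ := hG.2.1 d
    exact ⟨_, hb g⟩
  · intro c
    obtain ⟨c, rfl⟩ := hB.2.1 c
    rw [ha, hb, hG.apply_apply]
  · intro y hy
    obtain ⟨y, rfl⟩ := hS.2.1 y
    obtain ⟨x, rfl⟩ := hG.exists_of_apply_eq_zero ((hb _).symm.trans hy)
    exact ⟨_, ha x⟩

/-- Embedding the middle term of a sequence which is split by `ρ`. -/
lemma prod_comp {f : A →ₗ[R] B} {g : B →ₗ[R] C} (h : IsShortExact R f g) {ρ : B →ₗ[R] A}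
    (hρ : ρ.comp f = LinearMap.id) {i : C →ₗ[R] G} {p : G →ₗ[R] D} (hG : IsShortExact R i p) :
    IsShortExact R (ρ.prod (i.comp g)) (p.comp (LinearMap.snd R A G)) := by
  have hρ' (x) : ρ (f x) = x := LinearMap.congr_fun hρ x
  refine of_forall ?_ (hG.2.1.comp Prod.snd_surjective) (fun b ↦ by simp [hG.apply_apply]) ?_
  · refine (injective_iff_map_eq_zero _).2 fun y hy ↦ ?_
    have hy₁ : ρ y = 0 := congrArg Prod.fst hy
    have hy₂ : i (g y) = 0 := congrArg Prod.snd hy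
    obtain ⟨x, rfl⟩ := h.exists_of_apply_eq_zero (hG.1 (hy₂.trans (map_zero i).symm))
    rw [← hρ' x, hy₁, map_zero]
  · rintro ⟨x, z⟩ hz
    obtain ⟨c, rfl⟩ := hG.exists_of_apply_eq_zero hz
    obtain ⟨b, rfl⟩ := h.2.1 c
    exact ⟨b + f (x - ρ b), by simp [hρ', h.apply_apply]⟩

section Category

open CategoryTheory Abelian

/-- The short complex of modules attached to a short exact sequence. -/
abbrev shortComplex {f : A →ₗ[R] B} {g : B →ₗ[R] C} (h : IsShortExact R f g) :
    ShortComplex (ModuleCat.{u} R) :=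
  ShortComplex.mk (ModuleCat.ofHom f) (ModuleCat.ofHom g)
    (by ext a; exact h.apply_apply a)

lemma shortExact {f : A →ₗ[R] B} {g : B →ₗ[R] C} (h : IsShortExact R f g) :
    h.shortComplex.ShortExact :=
  ModuleCat.shortComplex_shortExact _ (LinearMap.exact_iff.2 h.2.2.symm) h.1 h.2.1

end Category

end IsShortExact

section ExtZero

open CategoryTheory Abelian

/-- `Ext^i(M, N) = 0`, for the `Ext` groups defined through the derived category. -/
abbrev ExtZero (M N : Type u) [AddCommGroup M] [Module R M] [AddCommGroup N] [Module R N]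
    (i : ℕ) : Prop :=
  ∀ e : Abelian.Ext (ModuleCat.of R M) (ModuleCat.of R N) i, e = 0

variable {A B C N : Type u} [AddCommGroup A] [Module R A] [AddCommGroup B] [Module R B]
  [AddCommGroup C] [Module R C] [AddCommGroup N] [Module R N]
  {f : A →ₗ[R] B} {g : B →ₗ[R] C}

lemma ExtZero.of_projective [Module.Projective R A] (i : ℕ) : ExtZero (R := R) A N (i + 1) :=
  fun e ↦
    have := (IsProjective.iff_projective (R := R) A).1 inferInstance
    e.eq_zero_of_projective

lemma ExtZero.of_injective [Module.Injective R N] (i : ℕ) : ExtZero (R := R) A N (i + 1) :=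
  fun e ↦
    have := (Module.injective_iff_injective_object R N).1 inferInstance
    e.eq_zero_of_injective

lemma ExtZero.of_subsingleton_left [Subsingleton A] (i : ℕ) : ExtZero (R := R) A N i :=
  fun e ↦
    have := (ModuleCat.isZero_of_subsingleton (ModuleCat.of R A)).hasProjectiveDimensionLT_zero
    e.eq_zero_of_hasProjectiveDimensionLT 0 i.zero_le

namespace IsShortExact

lemma extZero_left (h : IsShortExact R f g) {i : ℕ} (hB : ExtZero (R := R) B N i)
    (hC : ExtZero (R := R) C N (i + 1)) : ExtZero (R := R) A N i := fun e ↦ by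
  obtain ⟨x, rfl⟩ := Ext.contravariant_sequence_exact₁ h.shortExact _ e (add_comm 1 i) (hC _)
  rw [hB x, Ext.comp_zero]

lemma extZero_middle (h : IsShortExact R f g) {i : ℕ} (hA : ExtZero (R := R) A N i)
    (hC : ExtZero (R := R) C N i) : ExtZero (R := R) B N i := fun e ↦ by
  obtain ⟨x, rfl⟩ := Ext.contravariant_sequence_exact₂ h.shortExact _ e (hA _)
  rw [hC x, Ext.comp_zero]

lemma extZero_right (h : IsShortExact R f g) {i : ℕ} (hA : ExtZero (R := R) A N i)
    (hB : ExtZero (R := R) B N (i + 1)) : ExtZero (R := R) C N (i + 1) := fun e ↦ by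
  obtain ⟨x, rfl⟩ := Ext.contravariant_sequence_exact₃ h.shortExact _ e (hB _) (add_comm 1 i)
  rw [hA x, Ext.comp_zero]

lemma extZero_to_left (h : IsShortExact R f g) {i : ℕ} (hC : ExtZero (R := R) N C i)
    (hB : ExtZero (R := R) N B (i + 1)) : ExtZero (R := R) N A (i + 1) := fun e ↦ by
  obtain ⟨x, rfl⟩ := Ext.covariant_sequence_exact₁ _ h.shortExact e (hB _) rfl
  rw [hC x, Ext.zero_comp]

lemma extZero_to_right (h : IsShortExact R f g) {i : ℕ} (hB : ExtZero (R := R) N B i)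
    (hA : ExtZero (R := R) N A (i + 1)) : ExtZero (R := R) N C i := fun e ↦ by
  obtain ⟨x, rfl⟩ := Ext.covariant_sequence_exact₃ _ h.shortExact e rfl (hA _)
  rw [hB x, Ext.zero_comp]

/-- Extending maps along a monomorphism whose cokernel has no first `Ext`. -/
lemma exists_extend (h : IsShortExact R f g) (hC : ExtZero (R := R) C N 1) (φ : A →ₗ[R] N) :
    ∃ ψ : B →ₗ[R] N, ψ.comp f = φ := by
  obtain ⟨x, hx⟩ := Ext.contravariant_sequence_exact₁ h.shortExact _
    (Ext.mk₀ (ModuleCat.ofHom φ)) (add_zero 1) (hC _)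
  obtain ⟨ψ, rfl⟩ := Ext.homEquiv₀.symm.surjective x
  rw [Ext.homEquiv₀_symm_apply, Ext.mk₀_comp_mk₀] at hx
  have := Ext.homEquiv₀.symm.injective (a₁ := ModuleCat.ofHom f ≫ ψ) (a₂ := ModuleCat.ofHom φ) hx
  exact ⟨ψ.hom, congrArg ModuleCat.Hom.hom this⟩

lemma extZero_one_of_extend (h : IsShortExact R f g) (hB : ExtZero (R := R) B N 1)
    (hN : ∀ φ : A →ₗ[R] N, ∃ ψ : B →ₗ[R] N, ψ.comp f = φ) : ExtZero (R := R) C N 1 := fun e ↦ by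
  obtain ⟨x, rfl⟩ := Ext.contravariant_sequence_exact₃ h.shortExact _ e (hB _) (add_zero 1)
  obtain ⟨φ, rfl⟩ := Ext.homEquiv₀.symm.surjective x
  obtain ⟨ψ, hψ⟩ := hN φ.hom
  have hφ : φ = h.shortComplex.f ≫ ModuleCat.ofHom ψ := ModuleCat.hom_ext hψ.symm
  rw [Ext.homEquiv₀_symm_apply, hφ, ← Ext.mk₀_comp_mk₀, h.shortExact.extClass_comp_assoc]

end IsShortExact

lemma projective_of_extZero (h : ∀ (N : Type u) [AddCommGroup N] [Module R N],
    ExtZero (R := R) A N 1) : Module.Projective R A := by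
  rw [IsProjective.iff_projective, projective_iff_subsingleton_ext_one]
  exact fun Y ↦ subsingleton_of_forall_eq 0 (h Y)

lemma injective_of_extZero (h : ∀ (M : Type u) [AddCommGroup M] [Module R M],
    ExtZero (R := R) M A 1) : Module.Injective R A := by
  rw [Module.injective_iff_injective_object, injective_iff_subsingleton_ext_one]
  exact fun Y ↦ subsingleton_of_forall_eq 0 (h Y)

/-- Baer's criterion in terms of `Ext`. -/
lemma injective_of_extZero_ideal (h : ∀ I : Ideal R, ExtZero (R := R) (R ⧸ I) A 1) :
    Module.Injective R A := by
  refine Module.Baer.injective fun I φ ↦ ?_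
  obtain ⟨ψ, hψ⟩ := (IsShortExact.subtype_mkQ (R := R) I).exists_extend (h I) φ
  exact ⟨ψ, fun x hx ↦ LinearMap.congr_fun hψ ⟨x, hx⟩⟩

/-- `Ext` vanishing passes to direct summands in the first variable. -/
lemma ExtZero.of_retract {s : A →ₗ[R] B} {r : B →ₗ[R] A} (hr : r.comp s = LinearMap.id) {i : ℕ}
    (hB : ExtZero (R := R) B N i) : ExtZero (R := R) A N i := fun e ↦ by
  have hsr : ModuleCat.ofHom s ≫ ModuleCat.ofHom r = 𝟙 (ModuleCat.of R A) :=
    ModuleCat.hom_ext hr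
  rw [← e.mk₀_id_comp, ← hsr, ← Ext.mk₀_comp_mk₀,
    Ext.comp_assoc _ _ _ (zero_add 0) (zero_add i) (by simp),
    hB ((Ext.mk₀ (ModuleCat.ofHom r)).comp e (zero_add i)), Ext.comp_zero]

lemma exists_projective_presentation (M : Type u) [AddCommGroup M] [Module R M] :
    ∃ (K P : ModuleCat.{u} R) (f : K →ₗ[R] P) (g : P →ₗ[R] M),
      Module.Projective R P ∧ IsShortExact R f g := by
  obtain ⟨P⟩ := EnoughProjectives.presentation (ModuleCat.of R M)
  exact ⟨ModuleCat.of R (LinearMap.ker P.f.hom), P.p, _, P.f.hom,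
    (IsProjective.iff_projective (R := R) P.p).2 P.projective,
    .ker_subtype ((ModuleCat.epi_iff_surjective _).1 P.epi)⟩

lemma exists_injective_embedding (M : Type u) [AddCommGroup M] [Module R M] :
    ∃ (I Z : ModuleCat.{u} R) (f : M →ₗ[R] I) (g : I →ₗ[R] Z),
      Module.Injective R I ∧ IsShortExact R f g := by
  obtain ⟨I⟩ := EnoughInjectives.presentation (ModuleCat.of R M)
  exact ⟨I.J, ModuleCat.of R (I.J ⧸ LinearMap.range I.f.hom), I.f.hom, _,
    (Module.injective_iff_injective_object R I.J).2 I.injective,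
    .mkQ_range ((ModuleCat.mono_iff_injective _).1 I.mono)⟩

end ExtZero

section Resolutions

variable {X : ∀ (M : Type u) [AddCommGroup M] [Module R M], Prop}
  {p : ℕ → ∀ (M : Type u) [AddCommGroup M] [Module R M], Prop}

lemma left_resolution_induction
    (zero : ∀ (M : Type u) [AddCommGroup M] [Module R M] [Subsingleton M], p 0 M)
    (succ : ∀ (n : ℕ) {A B C : Type u} [AddCommGroup A] [Module R A] [AddCommGroup B] [Module R B]
      [AddCommGroup C] [Module R C] {f : A →ₗ[R] B} {g : B →ₗ[R] C},
      IsShortExact R f g → X B → p n A → p (n + 1) C)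
    (n : ℕ) {M : Type u} [AddCommGroup M] [Module R M] (P : ℕ → Type u)
    [∀ i, AddCommGroup (P i)] [∀ i, Module R (P i)] (d : ∀ i, P (i + 1) →ₗ[R] P i)
    (ε : P 0 →ₗ[R] M) (hP : ∀ i, X (P i)) (hn : ∀ i, n ≤ i → Subsingleton (P i))
    (hε : Function.Surjective ε) (h₀ : LinearMap.ker ε = LinearMap.range (d 0))
    (hd : ∀ i, LinearMap.ker (d i) = LinearMap.range (d (i + 1))) : p n M := by
  induction n generalizing M P with
  | zero =>
    have := hn 0 le_rfl
    have := hε.subsingleton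
    exact zero M
  | succ n ih =>
    refine succ n (.ker_subtype hε) (hP 0) (ih (fun i ↦ P (i + 1)) (fun i ↦ d (i + 1))
      ((d 0).codRestrict (LinearMap.ker ε) fun x ↦ h₀ ▸ LinearMap.mem_range_self _ x)
      (fun i ↦ hP (i + 1)) (fun i hi ↦ hn (i + 1) (by lia)) ?_ ?_ fun i ↦ hd (i + 1))
    · rintro ⟨x, hx⟩
      obtain ⟨y, rfl⟩ : x ∈ LinearMap.range (d 0) := h₀ ▸ hx
      exact ⟨y, rfl⟩
    · rw [LinearMap.ker_codRestrict, hd]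

lemma right_resolution_induction
    (zero : ∀ (M : Type u) [AddCommGroup M] [Module R M] [Subsingleton M], p 0 M)
    (succ : ∀ (n : ℕ) {A B C : Type u} [AddCommGroup A] [Module R A] [AddCommGroup B] [Module R B]
      [AddCommGroup C] [Module R C] {f : A →ₗ[R] B} {g : B →ₗ[R] C},
      IsShortExact R f g → X B → p n C → p (n + 1) A)
    (n : ℕ) {M : Type u} [AddCommGroup M] [Module R M] (E : ℕ → Type u)
    [∀ i, AddCommGroup (E i)] [∀ i, Module R (E i)] (d : ∀ i, E i →ₗ[R] E (i + 1))
    (η : M →ₗ[R] E 0) (hE : ∀ i, X (E i)) (hn : ∀ i, n ≤ i → Subsingleton (E i))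
    (hη : Function.Injective η) (h₀ : LinearMap.range η = LinearMap.ker (d 0))
    (hd : ∀ i, LinearMap.range (d i) = LinearMap.ker (d (i + 1))) : p n M := by
  induction n generalizing M E with
  | zero =>
    have := hn 0 le_rfl
    have := hη.subsingleton
    exact zero M
  | succ n ih =>
    refine succ n (g := (d 0).rangeRestrict)
      ⟨hη, (d 0).surjective_rangeRestrict, by rw [h₀, LinearMap.ker_rangeRestrict]⟩ (hE 0)
      (ih (fun i ↦ E (i + 1)) (fun i ↦ d (i + 1)) (LinearMap.range (d 0)).subtype
      (fun i ↦ hE (i + 1)) (fun i hi ↦ hn (i + 1) (by lia)) Subtype.val_injective ?_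
      fun i ↦ hd (i + 1))
    rw [Submodule.range_subtype, hd]

variable {A B C : Type u} [AddCommGroup A] [Module R A] [AddCommGroup B] [Module R B]
  [AddCommGroup C] [Module R C] {f : A →ₗ[R] B} {g : B →ₗ[R] C}

lemma IsShortExact.exists_left_resolution (h : IsShortExact R f g) (hA : X A) (hB : X B)
    (h₀ : X PUnit) :
    ∃ (P : ℕ → Type u) (_ : ∀ i, AddCommGroup (P i)) (_ : ∀ i, Module R (P i))
      (d : ∀ i, P (i + 1) →ₗ[R] P i) (ε : P 0 →ₗ[R] C),
      (∀ i, X (P i)) ∧ (∀ i, 1 < i → Subsingleton (P i)) ∧ Function.Surjective ε ∧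
      LinearMap.ker ε = LinearMap.range (d 0) ∧
      (∀ i, LinearMap.ker (d i) = LinearMap.range (d (i + 1))) := by
  let P : ℕ → ModuleCat.{u} R
    | 0 => ModuleCat.of R B
    | 1 => ModuleCat.of R A
    | _ + 2 => ModuleCat.of R PUnit
  let d : ∀ i, P (i + 1) →ₗ[R] P i
    | 0 => f
    | _ + 1 => 0
  refine ⟨fun i ↦ P i, fun i ↦ inferInstance, fun i ↦ inferInstance, d, g, ?_, ?_, h.2.1,
    h.2.2.symm, ?_⟩
  · rintro (_ | _ | i)
    exacts [hB, hA, h₀]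
  · rintro (_ | _ | i) hi
    · lia
    · lia
    · exact inferInstanceAs (Subsingleton PUnit)
  · rintro (_ | i)
    · exact (LinearMap.ker_eq_bot.2 h.1).trans LinearMap.range_zero.symm
    · exact (Submodule.eq_bot_of_subsingleton (R := R)).trans LinearMap.range_zero.symm

lemma IsShortExact.exists_right_resolution (h : IsShortExact R f g) (hB : X B) (hC : X C)
    (h₀ : X PUnit) :
    ∃ (E : ℕ → Type u) (_ : ∀ i, AddCommGroup (E i)) (_ : ∀ i, Module R (E i))
      (d : ∀ i, E i →ₗ[R] E (i + 1)) (η : A →ₗ[R] E 0),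
      (∀ i, X (E i)) ∧ (∀ i, 1 < i → Subsingleton (E i)) ∧ Function.Injective η ∧
      LinearMap.range η = LinearMap.ker (d 0) ∧
      (∀ i, LinearMap.range (d i) = LinearMap.ker (d (i + 1))) := by
  let E : ℕ → ModuleCat.{u} R
    | 0 => ModuleCat.of R B
    | 1 => ModuleCat.of R C
    | _ + 2 => ModuleCat.of R PUnit
  let d : ∀ i, E i →ₗ[R] E (i + 1)
    | 0 => g
    | _ + 1 => 0
  refine ⟨fun i ↦ E i, fun i ↦ inferInstance, fun i ↦ inferInstance, d, f, ?_, ?_, h.1,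
    h.2.2, ?_⟩
  · rintro (_ | _ | i)
    exacts [hB, hC, h₀]
  · rintro (_ | _ | i) hi
    · lia
    · lia
    · exact inferInstanceAs (Subsingleton PUnit)
  · rintro (_ | i)
    · exact (LinearMap.range_eq_top.2 h.2.1).trans LinearMap.ker_zero.symm
    · exact LinearMap.range_zero.trans (Submodule.eq_bot_of_subsingleton (R := R)).symm

end Resolutions

section GorensteinProjective

variable {A B C M : Type u} [AddCommGroup A] [Module R A] [AddCommGroup B] [Module R B]
  [AddCommGroup C] [Module R C] [AddCommGroup M] [Module R M] {f : A →ₗ[R] B} {g : B →ₗ[R] C}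

variable (R) in
/-- All higher `Ext` groups from `M` to projective modules vanish. -/
def ExtOrthogonal (M : Type u) [AddCommGroup M] [Module R M] : Prop :=
  ∀ (Q : Type u) [AddCommGroup Q] [Module R Q] [Module.Projective R Q] (i : ℕ),
    ExtZero (R := R) M Q (i + 1)

lemma ExtOrthogonal.of_projective [Module.Projective R M] : ExtOrthogonal R M :=
  fun _ _ _ _ i ↦ .of_projective i

lemma ExtOrthogonal.left (h : IsShortExact R f g) (hB : ExtOrthogonal R B)
    (hC : ExtOrthogonal R C) : ExtOrthogonal R A :=
  fun Q _ _ _ i ↦ h.extZero_left (hB Q i) (hC Q (i + 1))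

lemma ExtOrthogonal.middle (h : IsShortExact R f g) (hA : ExtOrthogonal R A)
    (hC : ExtOrthogonal R C) : ExtOrthogonal R B :=
  fun Q _ _ _ i ↦ h.extZero_middle (hA Q i) (hC Q i)

lemma exists_int_sequence {α : Type*} {r : α → α → Prop} {s t : α → Prop}
    (hs : ∀ x, s x → ∃ y, s y ∧ r x y) (ht : ∀ x, t x → ∃ y, t y ∧ r y x) {x : α}
    (hsx : s x) (htx : t x) : ∃ S : ℤ → α, S 1 = x ∧ ∀ i, r (S i) (S (i + 1)) := by
  choose! a ha har using hs
  choose! b hb hbr using ht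
  have hsa (n : ℕ) : s (a^[n] x) := by
    induction n with
    | zero => exact hsx
    | succ n ih => rw [Function.iterate_succ_apply']; exact ha _ ih
  have htb (n : ℕ) : t (b^[n] x) := by
    induction n with
    | zero => exact htx
    | succ n ih => rw [Function.iterate_succ_apply']; exact hb _ ih
  refine ⟨fun i ↦ if 1 ≤ i then a^[(i - 1).toNat] x else b^[(1 - i).toNat] x, by simp, fun i ↦ ?_⟩
  beta_reduce
  rcases lt_or_ge i 1 with hi | hi
  · obtain ⟨n, rfl⟩ : ∃ n : ℕ, i = - n := ⟨(-i).toNat, by lia⟩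
    have h₁ : (1 - (-n : ℤ)).toNat = n + 1 := by lia
    rw [if_neg (by lia), h₁, Function.iterate_succ_apply']
    have := hbr _ (htb n)
    cases n with
    | zero => simpa using this
    | succ n =>
      have h₂ : (1 - (-((n + 1 : ℕ) : ℤ) + 1)).toNat = n + 1 := by lia
      rwa [if_neg (by lia), h₂]
  · obtain ⟨n, rfl⟩ : ∃ n : ℕ, i = n + 1 := ⟨(i - 1).toNat, by lia⟩
    have h₁ : ((n + 1 : ℤ) - 1).toNat = n := by lia
    have h₂ : ((n + 1 : ℤ) + 1 - 1).toNat = n + 1 := by lia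
    rw [if_pos hi, if_pos (by lia), h₁, h₂, Function.iterate_succ_apply']
    exact har _ (hsa n)

lemma IsGorensteinProjective.of_linearEquiv (e : A ≃ₗ[R] B) (h : IsGorensteinProjective R A) :
    IsGorensteinProjective R B := by
  obtain ⟨P, _, _, d, hP, hd, ⟨e'⟩, hQ⟩ := h
  exact ⟨P, _, _, d, hP, hd, ⟨e.symm.trans e'⟩, hQ⟩

/-- A class of modules without higher `Ext` into projective modules, in which each module embeds
in a projective module with cokernel in the class, consists of Gorenstein projective modules. -/
theorem IsGorensteinProjective.of_coresolving {s : ModuleCat.{u} R → Prop}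
    (hs : ∀ M, s M → ExtOrthogonal R M ∧ ∃ (P N : ModuleCat.{u} R) (f : M →ₗ[R] P)
      (g : P →ₗ[R] N), Module.Projective R P ∧ IsShortExact R f g ∧ s N)
    {M : ModuleCat.{u} R} (hM : s M) : IsGorensteinProjective R M := by
  let r (X Y : ModuleCat.{u} R) : Prop := ExtOrthogonal R Y ∧
    ∃ (P : ModuleCat.{u} R) (f : X →ₗ[R] P) (g : P →ₗ[R] Y),
      Module.Projective R P ∧ IsShortExact R f g
  obtain ⟨S, rfl, hS⟩ := exists_int_sequence (r := r) (t := fun X ↦ ExtOrthogonal R X)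
    (fun X hX ↦ by
      obtain ⟨-, P, N, f, g, hP, h, hN⟩ := hs X hX
      exact ⟨N, hN, (hs N hN).1, P, f, g, hP, h⟩)
    (fun X hX ↦ by
      obtain ⟨K, P, f, g, hP, h⟩ := exists_projective_presentation (R := R) X
      exact ⟨K, .left h .of_projective hX, hX, P, f, g, hP, h⟩) hM (hs M hM).1
  choose horth P f g hP h using hS
  have hd (i) : LinearMap.range ((f (i + 1)).comp (g i)) = LinearMap.ker (g (i + 1)) := by
    rw [LinearMap.range_comp_of_range_eq_top _ (LinearMap.range_eq_top.2 (h i).2.1), (h _).2.2]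
  have hker (i) : LinearMap.ker ((f (i + 1)).comp (g i)) = LinearMap.ker (g i) :=
    LinearMap.ker_comp_of_ker_eq_bot _ (LinearMap.ker_eq_bot.2 (h _).1)
  refine ⟨fun i ↦ P i, fun i ↦ inferInstance, fun i ↦ inferInstance,
    fun i ↦ (f (i + 1)).comp (g i), hP, fun i ↦ (hd i).trans (hker (i + 1)).symm, ⟨?_⟩, ?_⟩
  · refine (LinearEquiv.ofInjective (f 1) (h 1).1).trans (LinearEquiv.ofEq _ _ ?_)
    exact (h 1).2.2.trans (hd 0).symm
  · intro Q _ _ _ i φ hφ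
    have hφ' (a) : φ (f (i + 1) a) = 0 := by
      obtain ⟨b, rfl⟩ := (h i).2.1 a
      exact LinearMap.congr_fun hφ b
    obtain ⟨l, hl⟩ := (h (i + 1)).exists_desc φ hφ'
    obtain ⟨ψ, hψ⟩ := (h (i + 1 + 1)).exists_extend (horth _ Q 0) l
    refine ⟨ψ, LinearMap.ext fun x ↦ ?_⟩
    rw [← hl, ← hψ]
    rfl

variable (R) in
/-- The syzygies of complete projective resolutions, in arbitrary degree. -/
def IsCompleteSyzygy (M : Type u) [AddCommGroup M] [Module R M] : Prop :=
  ∃ (P : ℤ → Type u) (_ : ∀ i, AddCommGroup (P i)) (_ : ∀ i, Module R (P i))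
    (d : ∀ i, P i →ₗ[R] P (i + 1)),
    (∀ i, Module.Projective R (P i)) ∧
    (∀ i, LinearMap.range (d i) = LinearMap.ker (d (i + 1))) ∧
    (∀ (Q : Type u) (_ : AddCommGroup Q) (_ : Module R Q), Module.Projective R Q →
      ∀ (i : ℤ) (g : P (i + 1) →ₗ[R] Q), g.comp (d i) = 0 →
        ∃ h : P (i + 1 + 1) →ₗ[R] Q, h.comp (d (i + 1)) = g) ∧
    ∃ i, Nonempty (M ≃ₗ[R] LinearMap.range (d i))

lemma IsGorensteinProjective.isCompleteSyzygy (h : IsGorensteinProjective R M) :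
    IsCompleteSyzygy R M := by
  obtain ⟨P, _, _, d, hP, hd, he, hQ⟩ := h
  exact ⟨P, _, _, d, hP, hd, hQ, 0, he⟩

lemma IsCompleteSyzygy.exists_embedding (h : IsCompleteSyzygy R M) :
    ∃ (P N : ModuleCat.{u} R) (f : M →ₗ[R] P) (g : P →ₗ[R] N), Module.Projective R P ∧
      IsShortExact R f g ∧ IsCompleteSyzygy R N := by
  obtain ⟨P, _, _, d, hP, hd, hQ, i, ⟨e⟩⟩ := h
  refine ⟨ModuleCat.of R (P (i + 1)), ModuleCat.of R (LinearMap.range (d (i + 1))),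
    (LinearMap.range (d i)).subtype.comp e.toLinearMap, (d (i + 1)).rangeRestrict, hP _,
    ⟨Subtype.val_injective.comp e.injective, (d (i + 1)).surjective_rangeRestrict, ?_⟩,
    P, _, _, d, hP, hd, hQ, i + 1, ⟨LinearEquiv.refl R _⟩⟩
  rw [LinearMap.range_comp_of_range_eq_top _ e.range, Submodule.range_subtype,
    LinearMap.ker_rangeRestrict, hd]

lemma IsCompleteSyzygy.extOrthogonal (h : IsCompleteSyzygy R M) : ExtOrthogonal R M := by
  obtain ⟨P, _, _, d, hP, hd, hQ, i, ⟨e⟩⟩ := h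
  intro Q _ _ _ k
  have hS (j) : IsShortExact R (LinearMap.range (d j)).subtype (d (j + 1)).rangeRestrict :=
    ⟨Subtype.val_injective, (d (j + 1)).surjective_rangeRestrict, by
      rw [Submodule.range_subtype, LinearMap.ker_rangeRestrict, hd]⟩
  have key (j : ℤ) : ExtZero (R := R) (LinearMap.range (d j)) Q (k + 1) := by
    induction k generalizing j with
    | zero =>
      obtain ⟨j, rfl⟩ : ∃ l, j = l + 1 + 1 := ⟨j - 2, by lia⟩
      refine (hS _).extZero_one_of_extend (.of_projective 0) fun φ ↦ ?_
      obtain ⟨ψ, hψ⟩ := hQ Q _ _ inferInstance j (φ.comp (d (j + 1)).rangeRestrict) <| by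
        ext x
        have : (d (j + 1)).rangeRestrict (d j x) = 0 :=
          Subtype.ext ((hd j).le (LinearMap.mem_range_self _ x))
        simp [this]
      refine ⟨ψ, LinearMap.ext fun ⟨_, x, rfl⟩ ↦ LinearMap.congr_fun hψ x⟩
    | succ k ih =>
      obtain ⟨j, rfl⟩ : ∃ l, j = l + 1 := ⟨j - 1, by lia⟩
      exact (hS j).extZero_right (ih j) (.of_projective _)
  exact .of_retract (r := e.symm.toLinearMap) (s := e.toLinearMap) (by ext; simp) (key i)

lemma IsCompleteSyzygy.isGorensteinProjective (h : IsCompleteSyzygy R M) :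
    IsGorensteinProjective R M :=
  .of_coresolving (s := fun N ↦ IsCompleteSyzygy R N) (M := ModuleCat.of R M)
    (fun _ hN ↦ ⟨hN.extOrthogonal, hN.exists_embedding⟩) h

namespace IsGorensteinProjective

lemma extOrthogonal (h : IsGorensteinProjective R M) : ExtOrthogonal R M :=
  h.isCompleteSyzygy.extOrthogonal

lemma exists_embedding (h : IsGorensteinProjective R M) :
    ∃ (P N : ModuleCat.{u} R) (f : M →ₗ[R] P) (g : P →ₗ[R] N), Module.Projective R P ∧
      IsShortExact R f g ∧ IsGorensteinProjective R N := by
  obtain ⟨P, N, f, g, hP, hS, hN⟩ := h.isCompleteSyzygy.exists_embedding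
  exact ⟨P, N, f, g, hP, hS, hN.isGorensteinProjective⟩

lemma of_embedding (h : IsShortExact R f g) (hA : ExtOrthogonal R A) [hB : Module.Projective R B]
    (hC : IsGorensteinProjective R C) : IsGorensteinProjective R A := by
  refine of_coresolving (s := fun N ↦ ExtOrthogonal R N ∧ ∃ (P N' : ModuleCat.{u} R)
    (f : N →ₗ[R] P) (g : P →ₗ[R] N'), Module.Projective R P ∧ IsShortExact R f g ∧
      IsGorensteinProjective R N') (M := ModuleCat.of R A) ?_
    ⟨hA, ModuleCat.of R B, ModuleCat.of R C, f, g, hB, h, hC⟩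
  rintro N ⟨hN, P, N', f, g, hP, hS, hN'⟩
  exact ⟨hN, P, N', f, g, hP, hS, hN'.extOrthogonal, hN'.exists_embedding⟩

lemma of_projective [hM : Module.Projective R M] : IsGorensteinProjective R M :=
  of_coresolving (s := fun N ↦ Module.Projective R N) (M := ModuleCat.of R M)
    (fun N hN ↦ ⟨.of_projective, N, ModuleCat.of R PUnit, LinearMap.id, 0, hN, .id_zero,
      inferInstanceAs (Module.Projective R PUnit.{u + 1})⟩) hM

/-- Gorenstein projective modules are closed under extensions. -/
theorem of_extension (h : IsShortExact R f g) (hA : IsGorensteinProjective R A)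
    (hC : IsGorensteinProjective R C) : IsGorensteinProjective R B := by
  refine of_coresolving (s := fun N ↦ ∃ (A C : ModuleCat.{u} R) (f : A →ₗ[R] N) (g : N →ₗ[R] C),
    IsShortExact R f g ∧ IsGorensteinProjective R A ∧ IsGorensteinProjective R C)
    (M := ModuleCat.of R B) ?_ ⟨ModuleCat.of R A, ModuleCat.of R C, f, g, h, hA, hC⟩
  rintro N ⟨A, C, f, g, h, hA, hC⟩
  refine ⟨.middle h hA.extOrthogonal hC.extOrthogonal, ?_⟩
  obtain ⟨P, A', a, a', hP, hPA, hA'⟩ := hA.exists_embedding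
  obtain ⟨P', C', c, c', hP', hPC, hC'⟩ := hC.exists_embedding
  obtain ⟨Y, i, r, j, s, hY, hY'⟩ := h.exists_pushout hPA
  obtain ⟨ρ, hρ⟩ := hY.exists_extend (hC.extOrthogonal P 0) LinearMap.id
  obtain ⟨Z, b, b', π, hZ, hZ'⟩ := hY'.exists_coker_comp (hY.prod_comp hρ hPC)
  exact ⟨ModuleCat.of R (P × P'), Z, _, π, inferInstanceAs (Module.Projective R (P × P')), hZ',
    A', C', b, b', hZ, hA', hC'⟩

end IsGorensteinProjective

end GorensteinProjective

section Dimension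

variable {A B C M : Type u} [AddCommGroup A] [Module R A] [AddCommGroup B] [Module R B]
  [AddCommGroup C] [Module R C] [AddCommGroup M] [Module R M] {f : A →ₗ[R] B} {g : B →ₗ[R] C}

variable (R) in
/-- `Ext^i(M, -) = 0` for all `n ≤ i`. -/
def ProjDimLT (M : Type u) [AddCommGroup M] [Module R M] (n : ℕ) : Prop :=
  ∀ (N : Type u) [AddCommGroup N] [Module R N] (i : ℕ), n ≤ i → ExtZero (R := R) M N i

variable (R) in
/-- `Ext^i(-, M) = 0` for all `n ≤ i`. -/
def InjDimLT (M : Type u) [AddCommGroup M] [Module R M] (n : ℕ) : Prop :=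
  ∀ (N : Type u) [AddCommGroup N] [Module R N] (i : ℕ), n ≤ i → ExtZero (R := R) N M i

lemma ExtZero.of_projective_of_le [Module.Projective R M] {N : Type u} [AddCommGroup N]
    [Module R N] {i : ℕ} (hi : 1 ≤ i) : ExtZero (R := R) M N i := by
  obtain ⟨i, rfl⟩ := Nat.exists_eq_add_of_le' hi
  exact .of_projective i

lemma ExtZero.of_injective_of_le {N : Type u} [AddCommGroup N]
    [Module R N] [Module.Injective R N] {i : ℕ} (hi : 1 ≤ i) : ExtZero (R := R) M N i := by
  obtain ⟨i, rfl⟩ := Nat.exists_eq_add_of_le' hi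
  exact .of_injective i

namespace ProjDimLT

lemma of_subsingleton [Subsingleton M] (n : ℕ) : ProjDimLT R M n :=
  fun _ _ _ i _ ↦ .of_subsingleton_left i

lemma of_projective [Module.Projective R M] : ProjDimLT R M 1 :=
  fun _ _ _ _ hi ↦ .of_projective_of_le hi

protected lemma mono {m n : ℕ} (h : ProjDimLT R M m) (hmn : m ≤ n) : ProjDimLT R M n :=
  fun N _ _ i hi ↦ h N i (hmn.trans hi)

protected lemma right (h : IsShortExact R f g) {n : ℕ} (hA : ProjDimLT R A n)
    (hB : ProjDimLT R B (n + 1)) : ProjDimLT R C (n + 1) := by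
  intro N _ _ i hi
  obtain ⟨i, rfl⟩ := Nat.exists_eq_add_of_le' (le_of_add_le_right hi)
  exact h.extZero_right (hA N i (by lia)) (hB N _ hi)

protected lemma left (h : IsShortExact R f g) {n : ℕ} (hB : ProjDimLT R B n)
    (hC : ProjDimLT R C (n + 1)) : ProjDimLT R A n :=
  fun N _ _ i hi ↦ h.extZero_left (hB N i hi) (hC N (i + 1) (by lia))

/-- A module of finite projective dimension without `Ext` into projective modules from degree `m`
on has projective dimension less than `m`. -/
lemma of_extZero {m : ℕ} (hm : ∀ (Q : Type u) [AddCommGroup Q] [Module R Q]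
    [Module.Projective R Q] (i : ℕ), m ≤ i → ExtZero (R := R) M Q i) {n : ℕ}
    (hn : ProjDimLT R M n) : ProjDimLT R M m := by
  induction n with
  | zero => exact hn.mono m.zero_le
  | succ n ih =>
    rcases le_or_gt (n + 1) m with h | h
    · exact hn.mono h
    · refine ih fun Y _ _ i hi ↦ ?_
      obtain ⟨K, F, f, g, hF, h'⟩ := exists_projective_presentation (R := R) Y
      exact h'.extZero_to_right (hm F i (by lia)) (hn K (i + 1) (by lia))

lemma projDimLE (h : ProjDimLT R M 2) : ProjDimLE R M 1 := by
  obtain ⟨K, F, f, g, hF, h'⟩ := exists_projective_presentation (R := R) M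
  have hK : Module.Projective R K := projective_of_extZero fun N _ _ ↦
    ProjDimLT.left h' of_projective h N 1 le_rfl
  exact h'.exists_left_resolution (X := fun N _ _ ↦ Module.Projective R N) hK hF
    (inferInstanceAs (Module.Projective R PUnit.{u + 1}))

end ProjDimLT

lemma ProjDimLE.of_projective [hM : Module.Projective R M] : ProjDimLE R M 1 := by
  have h₀ : Module.Projective R PUnit.{u + 1} := inferInstance
  have h : IsShortExact R (0 : PUnit.{u + 1} →ₗ[R] M) LinearMap.id := .zero_id
  exact h.exists_left_resolution (X := fun N _ _ ↦ Module.Projective R N) h₀ hM h₀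

lemma ProjDimLE.projDimLT {n : ℕ} (h : ProjDimLE R M n) : ProjDimLT R M (n + 1) := by
  obtain ⟨P, _, _, d, ε, hP, hn, hε, h₀, hd⟩ := h
  refine left_resolution_induction (X := fun N _ _ ↦ Module.Projective R N)
    (p := fun n N _ _ ↦ ProjDimLT R N n) (fun N _ _ _ ↦ .of_subsingleton 0)
    (fun n {A B C} _ _ _ _ _ _ f g hS hB hA ↦ .right hS hA ?_) (n + 1) P d ε hP hn hε h₀ hd
  exact ProjDimLT.of_projective.mono (by lia)

namespace InjDimLT

lemma of_subsingleton [Subsingleton M] (n : ℕ) : InjDimLT R M n :=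
  fun _ _ _ i _ e ↦
    have := (ModuleCat.isZero_of_subsingleton (ModuleCat.of R M)).hasInjectiveDimensionLT_zero
    e.eq_zero_of_hasInjectiveDimensionLT 0 i.zero_le

lemma of_injective [Module.Injective R M] : InjDimLT R M 1 :=
  fun _ _ _ _ hi ↦ .of_injective_of_le hi

protected lemma mono {m n : ℕ} (h : InjDimLT R M m) (hmn : m ≤ n) : InjDimLT R M n :=
  fun N _ _ i hi ↦ h N i (hmn.trans hi)

protected lemma left (h : IsShortExact R f g) {n : ℕ} (hB : InjDimLT R B (n + 1))
    (hC : InjDimLT R C n) : InjDimLT R A (n + 1) := by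
  intro N _ _ i hi
  obtain ⟨i, rfl⟩ := Nat.exists_eq_add_of_le' (le_of_add_le_right hi)
  exact h.extZero_to_left (hC N i (by lia)) (hB N _ hi)

protected lemma right (h : IsShortExact R f g) {n : ℕ} (hA : InjDimLT R A (n + 1))
    (hB : InjDimLT R B n) : InjDimLT R C n :=
  fun N _ _ i hi ↦ h.extZero_to_right (hB N i hi) (hA N (i + 1) (by lia))

/-- A module of finite injective dimension without `Ext` from injective modules from degree `m`
on has injective dimension less than `m`. -/
lemma of_extZero {m : ℕ} (hm : ∀ (E : Type u) [AddCommGroup E] [Module R E]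
    [Module.Injective R E] (i : ℕ), m ≤ i → ExtZero (R := R) E M i) {n : ℕ}
    (hn : InjDimLT R M n) : InjDimLT R M m := by
  induction n with
  | zero => exact hn.mono m.zero_le
  | succ n ih =>
    rcases le_or_gt (n + 1) m with h | h
    · exact hn.mono h
    · refine ih fun Y _ _ i hi ↦ ?_
      obtain ⟨I, Z, f, g, hI, h'⟩ := exists_injective_embedding (R := R) Y
      exact h'.extZero_left (hm I i (by lia)) (hn Z (i + 1) (by lia))

end InjDimLT

lemma Module.Injective.of_subsingleton [Subsingleton M] : Module.Injective R M :=
  injective_of_extZero fun N _ _ ↦ InjDimLT.of_subsingleton 0 N 1 zero_le_one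

/-- It suffices to test injective dimension at most one on cyclic modules. -/
lemma InjDimLE.of_extZero_ideal (h : ∀ I : Ideal R, ExtZero (R := R) (R ⧸ I) M 2) :
    InjDimLE R M 1 := by
  obtain ⟨E, Z, f, g, hE, h'⟩ := exists_injective_embedding (R := R) M
  have hZ : Module.Injective R Z := injective_of_extZero_ideal fun I ↦
    h'.extZero_to_right (.of_injective 0) (h I)
  have h₀ : Module.Injective R PUnit.{u + 1} := .of_subsingleton
  exact h'.exists_right_resolution (X := fun N _ _ ↦ Module.Injective R N) hE hZ h₀

lemma InjDimLE.of_injective [hM : Module.Injective R M] : InjDimLE R M 1 := by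
  have h₀ : Module.Injective R PUnit.{u + 1} := .of_subsingleton
  have h : IsShortExact R LinearMap.id (0 : M →ₗ[R] PUnit.{u + 1}) := .id_zero
  exact h.exists_right_resolution (X := fun N _ _ ↦ Module.Injective R N) hM h₀ h₀

lemma InjDimLT.injDimLE (h : InjDimLT R M 2) : InjDimLE R M 1 :=
  .of_extZero_ideal fun I ↦ h (R ⧸ I) 2 le_rfl

lemma InjDimLE.injDimLT {n : ℕ} (h : InjDimLE R M n) : InjDimLT R M (n + 1) := by
  obtain ⟨E, _, _, d, η, hE, hn, hη, h₀, hd⟩ := h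
  refine right_resolution_induction (X := fun N _ _ ↦ Module.Injective R N)
    (p := fun n N _ _ ↦ InjDimLT R N n) (fun N _ _ _ ↦ .of_subsingleton 0)
    (fun n {A B C} _ _ _ _ _ _ f g hS hB hC ↦ .left hS ?_ hC) (n + 1) E d η hE hn hη h₀ hd
  exact InjDimLT.of_injective.mono (by lia)

namespace GProjDimLE

lemma extZero {n : ℕ} (h : GProjDimLE R M n) {Q : Type u} [AddCommGroup Q] [Module R Q]
    [Module.Projective R Q] {i : ℕ} (hi : n < i) : ExtZero (R := R) M Q i := by
  obtain ⟨G, _, _, d, ε, hG, hn, hε, h₀, hd⟩ := h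
  refine left_resolution_induction (X := fun N _ _ ↦ IsGorensteinProjective R N)
    (p := fun n N _ _ ↦ ∀ i, n ≤ i → ExtZero (R := R) N Q i)
    (fun N _ _ _ i _ ↦ .of_subsingleton_left i)
    (fun n {A B C} _ _ _ _ _ _ f g hS hB hA i hi ↦ ?_) (n + 1) G d ε hG hn hε h₀ hd i hi
  obtain ⟨i, rfl⟩ := Nat.exists_eq_add_of_le' (le_of_add_le_right hi)
  exact hS.extZero_right (hA i (by lia)) (hB.extOrthogonal Q i)

/-- A module of finite Gorenstein projective dimension embeds in a module of finite projective
dimension with Gorenstein projective cokernel. -/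
theorem exists_embedding {n : ℕ} (h : GProjDimLE R M n) :
    ∃ (H G : ModuleCat.{u} R) (f : M →ₗ[R] H) (g : H →ₗ[R] G) (k : ℕ),
      IsShortExact R f g ∧ ProjDimLT R H k ∧ IsGorensteinProjective R G := by
  obtain ⟨G, _, _, d, ε, hG, hn, hε, h₀, hd⟩ := h
  refine left_resolution_induction (X := fun N _ _ ↦ IsGorensteinProjective R N)
    (p := fun _ M _ _ ↦ ∃ (H G : ModuleCat.{u} R) (f : M →ₗ[R] H) (g : H →ₗ[R] G) (k : ℕ),
      IsShortExact R f g ∧ ProjDimLT R H k ∧ IsGorensteinProjective R G)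
    (fun N _ _ _ ↦ ⟨ModuleCat.of R N, ModuleCat.of R PUnit, LinearMap.id, 0, 0, ?_,
      .of_subsingleton 0, ?_⟩)
    (fun n {A B C} _ _ _ _ _ _ f g hS hB hA ↦ ?_) (n + 1) G d ε hG hn hε h₀ hd
  · exact .id_zero
  · have : Module.Projective R PUnit.{u + 1} := inferInstance
    exact .of_projective (M := PUnit)
  · obtain ⟨H, G', a, b, k, hH, hk, hG'⟩ := hA
    obtain ⟨X, i, r, j, s, hX, hX'⟩ := hS.exists_pushout hH
    obtain ⟨P, D, c, e, hP, hc, hD⟩ :=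
      (IsGorensteinProjective.of_extension hX' hB hG').exists_embedding
    obtain ⟨Y, y, z, p, hY, hY'⟩ := hX.exists_coker_comp hc
    exact ⟨Y, D, y, z, k + 1, hY, .right hY' hk (ProjDimLT.of_projective.mono (by lia)), hD⟩

end GProjDimLE


end Dimension
end Auxiliary
/-- Proposition 2.3: characterizations of Gorenstein hereditary rings among rings of finite
Gorenstein global dimension. -/
theorem statement_1 (R : Type u) [CommRing R]
    (hfin : ∃ n : ℕ, ∀ (M : Type u) (_ : AddCommGroup M) (_ : Module R M), GProjDimLE R M n) :
    List.TFAE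
      [ IsGHereditaryRing R,
        ∀ (M : Type u) (_ : AddCommGroup M) (_ : Module R M), Module.Finite R M →
          GProjDimLE R M 1,
        ∀ I : Ideal R, IsGorensteinProjective R I,
        ∀ (P : Type u) (_ : AddCommGroup P) (_ : Module R P),
          (∃ n : ℕ, ProjDimLE R P n) → InjDimLE R P 1,
        ∀ (P' : Type u) (_ : AddCommGroup P') (_ : Module R P'), Module.Projective R P' →
          InjDimLE R P' 1,
        ∀ (E : Type u) (_ : AddCommGroup E) (_ : Module R E),
          (∃ n : ℕ, InjDimLE R E n) → ProjDimLE R E 1,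
        ∀ (E' : Type u) (_ : AddCommGroup E') (_ : Module R E'), Module.Injective R E' →
          ProjDimLE R E' 1 ] := by
  obtain ⟨n, hfin⟩ := hfin
  have hQn (Q : Type u) [AddCommGroup Q] [Module R Q] [Module.Projective R Q] :
      InjDimLT R Q (n + 1) :=
    fun N _ _ _ hi ↦ (hfin N _ _).extZero hi
  tfae_have 1 → 2 := fun h M _ _ _ ↦ by
    obtain ⟨K, F, f, g, hF, hS⟩ := exists_projective_presentation (R := R) M
    exact hS.exists_left_resolution (X := fun N _ _ ↦ IsGorensteinProjective R N)
      (.of_linearEquiv (LinearEquiv.ofInjective f hS.1).symm (h F _ _ hF _)) .of_projective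
      .of_projective
  tfae_have 1 → 3 := fun h I ↦ h R _ _ inferInstance I
  tfae_have 2 → 5 := fun h Q _ _ _ ↦
    .of_extZero_ideal fun I ↦ (h (R ⧸ I) _ _ inferInstance).extZero one_lt_two
  tfae_have 3 → 5 := fun h Q _ _ _ ↦ .of_extZero_ideal fun I ↦
    (IsShortExact.subtype_mkQ I).extZero_right ((h I).extOrthogonal Q 0) (.of_projective 1)
  tfae_have 5 → 4 := fun h P _ _ ⟨m, G, _, _, d, ε, hG, hn, hε, h₀, hd⟩ ↦ by
    refine InjDimLT.injDimLE (left_resolution_induction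
      (X := fun N _ _ ↦ Module.Projective R N) (p := fun _ N _ _ ↦ InjDimLT R N 2)
      (fun N _ _ _ ↦ .of_subsingleton 2)
      (fun n {A B C} _ _ _ _ _ _ f g hS hB hA ↦ ?_) (m + 1) G d ε hG hn hε h₀ hd)
    exact .right hS (hA.mono (by lia)) (h B _ _ hB).injDimLT
  tfae_have 4 → 5 := fun h Q _ _ _ ↦ h Q _ _ ⟨1, .of_projective⟩
  tfae_have 5 → 7 := fun h E _ _ hE ↦ by
    obtain ⟨H, G, f, g, k, hS, hk, -⟩ := (hfin E _ _).exists_embedding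
    obtain ⟨r, hr⟩ := hE.out f hS.1 LinearMap.id
    have hEk : ProjDimLT R E k := fun N _ _ i hi ↦
      .of_retract (r := r) (s := f) (LinearMap.ext hr) (hk N i hi)
    exact (ProjDimLT.of_extZero (fun Q _ _ hQ i hi ↦ (h Q _ _ hQ).injDimLT E i hi) hEk).projDimLE
  tfae_have 7 → 5 := fun h Q _ _ _ ↦
    (InjDimLT.of_extZero (fun E _ _ hE i hi ↦ (h E _ _ hE).projDimLT Q i hi) (hQn Q)).injDimLE
  tfae_have 7 → 6 := fun h P _ _ ⟨m, E, _, _, d, η, hE, hn, hη, h₀, hd⟩ ↦ by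
    refine ProjDimLT.projDimLE (right_resolution_induction
      (X := fun N _ _ ↦ Module.Injective R N) (p := fun _ N _ _ ↦ ProjDimLT R N 2)
      (fun N _ _ _ ↦ .of_subsingleton 2)
      (fun n {A B C} _ _ _ _ _ _ f g hS hB hC ↦ ?_) (m + 1) E d η hE hn hη h₀ hd)
    exact .left hS (h B _ _ hB).projDimLT (hC.mono (by lia))
  tfae_have 6 → 7 := fun h E _ _ _ ↦ h E _ _ ⟨1, .of_injective⟩
  tfae_have 5 → 1 := fun h P _ _ _ N ↦ by
    have hN : ExtOrthogonal R N := fun Q _ _ hQ i ↦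
      (IsShortExact.subtype_mkQ N).extZero_left (.of_projective i)
        ((h Q _ _ hQ).injDimLT _ (i + 1 + 1) (by lia))
    obtain ⟨H, G, f, g, k, hS, hk, hG⟩ := (hfin N _ _).exists_embedding
    have hH : ExtOrthogonal R H := .middle hS hN hG.extOrthogonal
    have hH₁ : ProjDimLT R H 1 := .of_extZero (fun Q _ _ _ i hi ↦ by
      obtain ⟨i, rfl⟩ := Nat.exists_eq_add_of_le' hi
      exact hH Q i) hk
    have : Module.Projective R H := projective_of_extZero fun Y _ _ ↦ hH₁ Y 1 le_rfl
    exact .of_embedding hS hN hG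
  tfae_finish
end
end

section
/- Let R be a commutative ring. The following assertions are equivalent: (1) R is SG-hereditary, i.e., every submodule of a projective R-module is strongly Gorenstein projective; (2) for every R-module M there exists a short exact sequence 0 → M → Q → M → 0 with pd_R(Q) ≤ 1, and for every projective R-module P there is an integer i > 1 such that Ext_R^i(M,P) = 0; (3) for every R-module M there exists a short exact sequence 0 → M → E → M → 0 with id_R(E) ≤ 1, and for every injective R-module I there is an integer i > 1 such that Ext_R^i(I,M) = 0. -/
noncomputable section

universe u

variable (R : Type u) [CommRing R]

section

open CategoryTheory Limits

variable {R}

lemma extVanishes_succ_iff (M N : Type u) [AddCommGroup M] [Module R M] [AddCommGroup N]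
    [Module R N] (n : ℕ) :
    ExtVanishes R M N (n + 1) ↔
      Subsingleton (Abelian.Ext (ModuleCat.of R M) (ModuleCat.of R N) (n + 1)) := by
  let P := projectiveResolution (ModuleCat.of R M)
  have h1 : ExtVanishes R M N (n + 1) ↔
      ∀ f : P.complex.X (n + 1) ⟶ ModuleCat.of R N, P.complex.d (n + 2) (n + 1) ≫ f = 0 →
        ∃ g : P.complex.X n ⟶ ModuleCat.of R N, P.complex.d (n + 1) n ≫ g = f := by
    rw [ExtVanishes, ← ModuleCat.isZero_iff_subsingleton,
      (P.isoExt (R := R) (n + 1) (ModuleCat.of R N)).isZero_iff,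
      ← HomologicalComplex.exactAt_iff_isZero_homology,
      HomologicalComplex.exactAt_iff' _ n (n + 1) (n + 2) (by simp) (by simp),
      ShortComplex.moduleCat_exact_iff]
    rfl
  rw [h1]
  constructor
  · intro h
    refine subsingleton_of_forall_eq 0 fun e ↦ ?_
    obtain ⟨f, hf, rfl⟩ := P.extMk_surjective e (n + 2) rfl
    exact (P.extMk_eq_zero_iff f _ rfl hf n rfl).2 (h f hf)
  · intro h f hf
    exact (P.extMk_eq_zero_iff f _ rfl hf n rfl).1 (Subsingleton.elim _ _)

variable {S : ShortComplex (ModuleCat.{u} R)}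

lemma subsingleton_ext_of_shortExact_left (hS : S.ShortExact) {Y : ModuleCat.{u} R} {n : ℕ}
    [Subsingleton (Abelian.Ext S.X₃ Y (n + 1))] [Subsingleton (Abelian.Ext S.X₂ Y n)] :
    Subsingleton (Abelian.Ext S.X₁ Y n) := by
  refine subsingleton_of_forall_eq 0 fun e ↦ ?_
  obtain ⟨x, rfl⟩ := Abelian.Ext.contravariant_sequence_exact₁ hS Y e (add_comm 1 n)
    (Subsingleton.elim _ _)
  rw [Subsingleton.elim x 0, Abelian.Ext.comp_zero]

lemma subsingleton_ext_of_shortExact_middle (hS : S.ShortExact) {Y : ModuleCat.{u} R} {n : ℕ}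
    [Subsingleton (Abelian.Ext S.X₁ Y n)] [Subsingleton (Abelian.Ext S.X₃ Y n)] :
    Subsingleton (Abelian.Ext S.X₂ Y n) := by
  refine subsingleton_of_forall_eq 0 fun e ↦ ?_
  obtain ⟨x, rfl⟩ := Abelian.Ext.contravariant_sequence_exact₂ hS Y e
    (Subsingleton.elim _ _)
  rw [Subsingleton.elim x 0, Abelian.Ext.comp_zero]

lemma subsingleton_ext_of_shortExact_right (hS : S.ShortExact) {X : ModuleCat.{u} R} {n : ℕ}
    [Subsingleton (Abelian.Ext X S.X₁ (n + 1))] [Subsingleton (Abelian.Ext X S.X₂ n)] :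
    Subsingleton (Abelian.Ext X S.X₃ n) := by
  refine subsingleton_of_forall_eq 0 fun e ↦ ?_
  obtain ⟨x, rfl⟩ := Abelian.Ext.covariant_sequence_exact₃ X hS e rfl
    (Subsingleton.elim _ _)
  rw [Subsingleton.elim x 0, Abelian.Ext.zero_comp]

lemma IsShortExact.shortExact_s2 {A B C : Type u} [AddCommGroup A] [Module R A] [AddCommGroup B]
    [Module R B] [AddCommGroup C] [Module R C] {f : A →ₗ[R] B} {g : B →ₗ[R] C}
    (h : IsShortExact R f g) :
    (ModuleCat.shortComplexOfCompEqZero f g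
      (LinearMap.range_le_ker_iff.1 h.2.2.le)).ShortExact where
  exact := (ShortComplex.ShortExact.moduleCat_exact_iff_function_exact _).2
    (LinearMap.exact_iff.2 h.2.2.symm)
  mono_f := (ModuleCat.mono_iff_injective _).2 h.1
  epi_g := (ModuleCat.epi_iff_surjective _).2 h.2.1

lemma IsShortExact.projDimLE_one {A B C : Type u} [AddCommGroup A] [Module R A] [AddCommGroup B]
    [Module R B] [AddCommGroup C] [Module R C] [Module.Projective R A] [Module.Projective R B]
    {f : A →ₗ[R] B} {g : B →ₗ[R] C} (h : IsShortExact R f g) : ProjDimLE R C 1 := by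
  obtain ⟨hf, hg, hfg⟩ := h
  refine ⟨fun | 0 => B | 1 => A | _ + 2 => PUnit,
    fun | 0 => ‹_› | 1 => ‹_› | _ + 2 => (inferInstance : AddCommGroup PUnit.{u + 1}),
    fun | 0 => ‹_› | 1 => ‹_› | _ + 2 => (inferInstance : Module R PUnit.{u + 1}),
    fun | 0 => f | 1 => (0 : PUnit.{u + 1} →ₗ[R] A) | _ + 2 => (0 : PUnit.{u + 1} →ₗ[R] PUnit.{u + 1}), g,
    fun | 0 => ‹_› | 1 => ‹_› | _ + 2 => (inferInstance : Module.Projective R PUnit.{u + 1}),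
    fun | 0, h => by omega | 1, h => by omega | _ + 2, _ => (inferInstance : Subsingleton PUnit.{u + 1}),
    hg, hfg.symm, fun | 0 => ?_ | 1 => ?_ | _ + 2 => ?_⟩
  · simpa using LinearMap.ker_eq_bot.2 hf
  · exact Subsingleton.elim (α := Submodule R PUnit.{u + 1}) _ _
  · exact Subsingleton.elim (α := Submodule R PUnit.{u + 1}) _ _

lemma IsShortExact.injDimLE_one {A B C : Type u} [AddCommGroup A] [Module R A] [AddCommGroup B]
    [Module R B] [AddCommGroup C] [Module R C] [Module.Injective R B] [Module.Injective R C]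
    {f : A →ₗ[R] B} {g : B →ₗ[R] C} (h : IsShortExact R f g) : InjDimLE R A 1 := by
  obtain ⟨hf, hg, hfg⟩ := h
  have : Module.Injective R PUnit.{u + 1} :=
    ⟨fun _ _ _ _ _ _ _ _ _ ↦ ⟨0, fun _ ↦ Subsingleton.elim _ _⟩⟩
  refine ⟨fun | 0 => B | 1 => C | _ + 2 => PUnit,
    fun | 0 => ‹_› | 1 => ‹_› | _ + 2 => (inferInstance : AddCommGroup PUnit.{u + 1}),
    fun | 0 => ‹_› | 1 => ‹_› | _ + 2 => (inferInstance : Module R PUnit.{u + 1}),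
    fun | 0 => g | 1 => (0 : C →ₗ[R] PUnit.{u + 1}) | _ + 2 => (0 : PUnit.{u + 1} →ₗ[R] PUnit.{u + 1}), f,
    fun | 0 => ‹_› | 1 => ‹_› | _ + 2 => this,
    fun | 0, h => by omega | 1, h => by omega | _ + 2, _ => (inferInstance : Subsingleton PUnit.{u + 1}),
    hf, hfg, fun | 0 => ?_ | 1 => ?_ | _ + 2 => ?_⟩
  · simpa using LinearMap.range_eq_top.2 hg
  · exact Subsingleton.elim (α := Submodule R PUnit.{u + 1}) _ _
  · exact Subsingleton.elim (α := Submodule R PUnit.{u + 1}) _ _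

lemma ProjDimLE.exists_isShortExact {M : Type u} [AddCommGroup M] [Module R M]
    (h : ProjDimLE R M 1) :
    ∃ (A B : Type u) (_ : AddCommGroup A) (_ : Module R A) (_ : AddCommGroup B) (_ : Module R B)
      (f : A →ₗ[R] B) (g : B →ₗ[R] M),
      Module.Projective R A ∧ Module.Projective R B ∧ IsShortExact R f g := by
  obtain ⟨P, _, _, d, ε, hP, hs, hε, h0, hd⟩ := h
  have := hs 2 (by omega)
  refine ⟨P 1, P 0, _, _, _, _, d 0, ε, hP 1, hP 0, LinearMap.ker_eq_bot.1 ?_, hε, h0.symm⟩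
  rw [hd 0, Subsingleton.elim (d (0 + 1)) 0, LinearMap.range_zero]

lemma InjDimLE.exists_isShortExact {M : Type u} [AddCommGroup M] [Module R M]
    (h : InjDimLE R M 1) :
    ∃ (A B : Type u) (_ : AddCommGroup A) (_ : Module R A) (_ : AddCommGroup B) (_ : Module R B)
      (f : M →ₗ[R] A) (g : A →ₗ[R] B),
      Module.Injective R A ∧ Module.Injective R B ∧ IsShortExact R f g := by
  obtain ⟨E, _, _, d, η, hE, hs, hη, h0, hd⟩ := h
  have := hs 2 (by omega)
  refine ⟨E 0, E 1, _, _, _, _, η, d 0, hE 0, hE 1, hη, LinearMap.range_eq_top.1 ?_, h0⟩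
  rw [hd 0, Subsingleton.elim (d (0 + 1)) 0, LinearMap.ker_zero]

lemma ProjDimLE.hasProjectiveDimensionLT {M : Type u} [AddCommGroup M] [Module R M]
    (h : ProjDimLE R M 1) : HasProjectiveDimensionLT (ModuleCat.of R M) 2 := by
  obtain ⟨A, B, _, _, _, _, f, g, hA, hB, hfg⟩ := h.exists_isShortExact
  have := (IsProjective.iff_projective A).1 hA
  have := (IsProjective.iff_projective B).1 hB
  exact hfg.shortExact_s2.hasProjectiveDimensionLT_X₃ 1 (by dsimp; infer_instance)
    (by dsimp; infer_instance)

lemma InjDimLE.hasInjectiveDimensionLT {M : Type u} [AddCommGroup M] [Module R M]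
    (h : InjDimLE R M 1) : HasInjectiveDimensionLT (ModuleCat.of R M) 2 := by
  obtain ⟨A, B, _, _, _, _, f, g, hA, hB, hfg⟩ := h.exists_isShortExact
  have := (Module.injective_iff_injective_object R A).1 hA
  have := (Module.injective_iff_injective_object R B).1 hB
  exact hfg.shortExact_s2.hasInjectiveDimensionLT_X₁ 1 (by dsimp; infer_instance)
    (by dsimp; infer_instance)

lemma IsShortExact.projective_left {A B C : Type u} [AddCommGroup A] [Module R A] [AddCommGroup B]
    [Module R B] [AddCommGroup C] [Module R C] [Module.Projective R B]
    {f : A →ₗ[R] B} {g : B →ₗ[R] C} (h : IsShortExact R f g)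
    (hC : HasProjectiveDimensionLT (ModuleCat.of R C) 2) : Module.Projective R A := by
  have hB := (IsProjective.iff_projective B).1 ‹Module.Projective R B›
  rw [IsProjective.iff_projective, projective_iff_hasProjectiveDimensionLT_one]
  exact (h.shortExact_s2.hasProjectiveDimensionLT_X₃_iff 0 hB).1 hC

lemma IsShortExact.injective_right {A B C : Type u} [AddCommGroup A] [Module R A] [AddCommGroup B]
    [Module R B] [AddCommGroup C] [Module R C] [Module.Injective R B]
    {f : A →ₗ[R] B} {g : B →ₗ[R] C} (h : IsShortExact R f g)
    (hA : HasInjectiveDimensionLT (ModuleCat.of R A) 2) : Module.Injective R C := by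
  have hB := (Module.injective_iff_injective_object R B).1 ‹Module.Injective R B›
  rw [Module.injective_iff_injective_object, injective_iff_hasInjectiveDimensionLT_one]
  exact (h.shortExact_s2.hasInjectiveDimensionLT_X₃_iff 0 hB).2 hA

lemma isShortExact_ker_subtype {P M : Type u} [AddCommGroup P] [Module R P] [AddCommGroup M]
    [Module R M] {π : P →ₗ[R] M} (hπ : Function.Surjective π) :
    IsShortExact R (A := LinearMap.ker π) (LinearMap.ker π).subtype π :=
  ⟨Subtype.val_injective, hπ, Submodule.range_subtype _⟩

lemma isShortExact_range_mkQ {M E : Type u} [AddCommGroup M] [Module R M] [AddCommGroup E]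
    [Module R E] {ι : M →ₗ[R] E} (hι : Function.Injective ι) :
    IsShortExact R ι (LinearMap.range ι).mkQ :=
  ⟨hι, Submodule.mkQ_surjective _, (Submodule.ker_mkQ _).symm⟩

lemma projDimLE_one_of_hasProjectiveDimensionLT {M : Type u} [AddCommGroup M] [Module R M]
    (h : HasProjectiveDimensionLT (ModuleCat.of R M) 2) : ProjDimLE R M 1 := by
  have hse := isShortExact_ker_subtype (Finsupp.linearCombination_id_surjective R M)
  have := hse.projective_left h
  exact hse.projDimLE_one

lemma injDimLE_one_of_hasInjectiveDimensionLT {M : Type u} [AddCommGroup M] [Module R M]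
    (h : HasInjectiveDimensionLT (ModuleCat.of R M) 2) : InjDimLE R M 1 := by
  obtain ⟨⟨J, _, j, _⟩⟩ := EnoughInjectives.presentation (ModuleCat.of R M)
  have hse := isShortExact_range_mkQ ((ModuleCat.mono_iff_injective j).1 ‹_›)
  have : Module.Injective R J := (Module.injective_iff_injective_object R J).2 ‹_›
  have := hse.injective_right h
  exact hse.injDimLE_one

lemma IsShortExact.subsingleton_ext_two_of_projDimLE {M Q : Type u} [AddCommGroup M] [Module R M]
    [AddCommGroup Q] [Module R Q] {ι : M →ₗ[R] Q} {π : Q →ₗ[R] M} (h : IsShortExact R ι π)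
    (hQ : ProjDimLE R Q 1) {Y : ModuleCat.{u} R} (n : ℕ)
    (hY : Subsingleton (Abelian.Ext (ModuleCat.of R M) Y (n + 2))) :
    Subsingleton (Abelian.Ext (ModuleCat.of R M) Y 2) := by
  have hQ' := hQ.hasProjectiveDimensionLT
  induction n with
  | zero => exact hY
  | succ n ih =>
    have := HasProjectiveDimensionLT.subsingleton (ModuleCat.of R Q) 2 (n + 2) (by omega) Y
    exact ih (subsingleton_ext_of_shortExact_left h.shortExact_s2)

lemma IsShortExact.subsingleton_ext_two_of_injDimLE {M E : Type u} [AddCommGroup M] [Module R M]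
    [AddCommGroup E] [Module R E] {ι : M →ₗ[R] E} {π : E →ₗ[R] M} (h : IsShortExact R ι π)
    (hE : InjDimLE R E 1) {X : ModuleCat.{u} R} (n : ℕ)
    (hX : Subsingleton (Abelian.Ext X (ModuleCat.of R M) (n + 2))) :
    Subsingleton (Abelian.Ext X (ModuleCat.of R M) 2) := by
  have hE' := hE.hasInjectiveDimensionLT
  induction n with
  | zero => exact hX
  | succ n ih =>
    have := HasInjectiveDimensionLT.subsingleton (ModuleCat.of R E) 2 (n + 2) (by omega) X
    exact ih (subsingleton_ext_of_shortExact_right h.shortExact_s2)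

/-- A module of projective dimension at most one is projective as soon as its first `Ext` groups
into projective modules vanish. -/
lemma projective_of_subsingleton_ext_one {Q : Type u} [AddCommGroup Q] [Module R Q]
    (hQ : HasProjectiveDimensionLT (ModuleCat.of R Q) 2)
    (h : ∀ (P : Type u) (_ : AddCommGroup P) (_ : Module R P), Module.Projective R P →
      Subsingleton (Abelian.Ext (ModuleCat.of R Q) (ModuleCat.of R P) 1)) :
    Module.Projective R Q := by
  rw [IsProjective.iff_projective, projective_iff_subsingleton_ext_one]
  intro Y
  have hS := ModuleCat.shortExact_projectiveShortComplex Y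
  have : Subsingleton (Abelian.Ext (ModuleCat.of R Q) Y.projectiveShortComplex.X₂ 1) :=
    h _ _ _ inferInstance
  have : Subsingleton (Abelian.Ext (ModuleCat.of R Q) Y.projectiveShortComplex.X₁ (1 + 1)) :=
    HasProjectiveDimensionLT.subsingleton _ 2 2 le_rfl _
  exact subsingleton_ext_of_shortExact_right hS

lemma IsShortExact.exists_extension {A B C D : Type u} [AddCommGroup A] [Module R A]
    [AddCommGroup B] [Module R B] [AddCommGroup C] [Module R C] [AddCommGroup D] [Module R D]
    {f : A →ₗ[R] B} {g : B →ₗ[R] C} (h : IsShortExact R f g)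
    [Subsingleton (Abelian.Ext (ModuleCat.of R C) (ModuleCat.of R D) 1)] (φ : A →ₗ[R] D) :
    ∃ ψ : B →ₗ[R] D, ψ ∘ₗ f = φ := by
  obtain ⟨x, hx⟩ := Abelian.Ext.contravariant_sequence_exact₁ h.shortExact_s2 (ModuleCat.of R D)
    (Abelian.Ext.mk₀ (ModuleCat.ofHom φ)) (add_zero 1) (Subsingleton.elim _ _)
  obtain ⟨y, rfl⟩ := Abelian.Ext.homEquiv₀.symm.surjective x
  rw [Abelian.Ext.homEquiv₀_symm_apply, Abelian.Ext.mk₀_comp_mk₀] at hx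
  have := (Abelian.Ext.mk₀_bijective _ _).1 hx
  exact ⟨y.hom, by simpa using congrArg ModuleCat.Hom.hom this⟩

lemma IsShortExact.subsingleton_ext_one {A B C D : Type u} [AddCommGroup A] [Module R A]
    [AddCommGroup B] [Module R B] [AddCommGroup C] [Module R C] [AddCommGroup D] [Module R D]
    [Module.Projective R B] {f : A →ₗ[R] B} {g : B →ₗ[R] C} (h : IsShortExact R f g)
    (hD : ∀ φ : A →ₗ[R] D, ∃ ψ : B →ₗ[R] D, ψ ∘ₗ f = φ) :
    Subsingleton (Abelian.Ext (ModuleCat.of R C) (ModuleCat.of R D) 1) := by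
  have hB := (IsProjective.iff_projective B).1 ‹Module.Projective R B›
  refine subsingleton_of_forall_eq 0 fun e ↦ ?_
  obtain ⟨x, rfl⟩ := Abelian.Ext.contravariant_sequence_exact₃ h.shortExact_s2 (ModuleCat.of R D) e
    (Abelian.Ext.eq_zero_of_projective (P := ModuleCat.of R B) _) (add_zero 1)
  obtain ⟨y, rfl⟩ := Abelian.Ext.homEquiv₀.symm.surjective x
  obtain ⟨ψ, hψ⟩ := hD y.hom
  have hy : y = ModuleCat.ofHom f ≫ ModuleCat.ofHom ψ := by
    ext1
    exact hψ.symm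
  rw [Abelian.Ext.homEquiv₀_symm_apply, hy, ← Abelian.Ext.mk₀_comp_mk₀]
  exact h.shortExact_s2.extClass_comp_assoc _

/-- If all projective modules have injective dimension at most one, then so do all modules of
projective dimension at most one. -/
lemma ProjDimLE.injDimLE_one
    (hR : ∀ (P : Type u) (_ : AddCommGroup P) (_ : Module R P), Module.Projective R P →
      HasInjectiveDimensionLT (ModuleCat.of R P) 2)
    {M : Type u} [AddCommGroup M] [Module R M] (h : ProjDimLE R M 1) : InjDimLE R M 1 := by
  obtain ⟨A, B, _, _, _, _, f, g, hA, hB, hfg⟩ := h.exists_isShortExact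
  have := hR A _ _ hA
  exact injDimLE_one_of_hasInjectiveDimensionLT
    (hfg.shortExact_s2.hasInjectiveDimensionLT_X₃ 2 (hR B _ _ hB) (by dsimp; infer_instance))

/-- If all injective modules have projective dimension at most one, then so do all modules of
injective dimension at most one. -/
lemma InjDimLE.projDimLE_one
    (hR : ∀ (I : Type u) (_ : AddCommGroup I) (_ : Module R I), Module.Injective R I →
      HasProjectiveDimensionLT (ModuleCat.of R I) 2)
    {M : Type u} [AddCommGroup M] [Module R M] (h : InjDimLE R M 1) : ProjDimLE R M 1 := by
  obtain ⟨A, B, _, _, _, _, f, g, hA, hB, hfg⟩ := h.exists_isShortExact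
  have := hR B _ _ hB
  exact projDimLE_one_of_hasProjectiveDimensionLT
    (hfg.shortExact_s2.hasProjectiveDimensionLT_X₁ 2 (hR A _ _ hA) (by dsimp; infer_instance))

lemma IsShortExact.hasProjectiveDimensionLT_left {I Q C : Type u} [AddCommGroup I] [Module R I]
    [AddCommGroup Q] [Module R Q] [AddCommGroup C] [Module R C] [Module.Injective R I]
    {ι : I →ₗ[R] Q} {π : Q →ₗ[R] C} (h : IsShortExact R ι π) (n : ℕ)
    [HasProjectiveDimensionLT (ModuleCat.of R Q) n] :
    HasProjectiveDimensionLT (ModuleCat.of R I) n := by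
  obtain ⟨r, hr⟩ := Module.Injective.out ι h.1 LinearMap.id
  refine Retract.hasProjectiveDimensionLT (Y := ModuleCat.of R Q)
    ⟨ModuleCat.ofHom ι, ModuleCat.ofHom r, ?_⟩ n
  ext x
  exact hr x

lemma IsShortExact.hasInjectiveDimensionLT_right {P E A : Type u} [AddCommGroup P] [Module R P]
    [AddCommGroup E] [Module R E] [AddCommGroup A] [Module R A] [Module.Projective R P]
    {ι : A →ₗ[R] E} {π : E →ₗ[R] P} (h : IsShortExact R ι π) (n : ℕ)
    [HasInjectiveDimensionLT (ModuleCat.of R E) n] :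
    HasInjectiveDimensionLT (ModuleCat.of R P) n := by
  obtain ⟨s, hs⟩ := Module.projective_lifting_property π LinearMap.id h.2.1
  refine Retract.hasInjectiveDimensionLT (Y := ModuleCat.of R E)
    ⟨ModuleCat.ofHom s, ModuleCat.ofHom π, ?_⟩ n
  ext x
  exact LinearMap.congr_fun hs x

/-- Strongly Gorenstein projective modules are those with a self-extension by a projective module
along which all maps to projective modules extend. -/
lemma isStronglyGorensteinProjective_iff (N : Type u) [AddCommGroup N] [Module R N] :
    IsStronglyGorensteinProjective R N ↔
      ∃ (P : Type u) (_ : AddCommGroup P) (_ : Module R P) (ι : N →ₗ[R] P) (π : P →ₗ[R] N),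
        Module.Projective R P ∧ IsShortExact R ι π ∧
        ∀ (Q : Type u) (_ : AddCommGroup Q) (_ : Module R Q), Module.Projective R Q →
          ∀ φ : N →ₗ[R] Q, ∃ ψ : P →ₗ[R] Q, ψ ∘ₗ ι = φ := by
  constructor
  · rintro ⟨P, _, _, f, hP, hf, ⟨e⟩, hext⟩
    have hιπ (x : P) : e (e.symm (f.rangeRestrict x)) = f x := by simp
    refine ⟨P, _, _, (LinearMap.range f).subtype ∘ₗ e, e.symm ∘ₗ f.rangeRestrict, hP,
      ⟨?_, ?_, ?_⟩, fun Q _ _ hQ φ ↦ ?_⟩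
    · exact Subtype.val_injective.comp e.injective
    · exact e.symm.surjective.comp f.surjective_rangeRestrict
    · rw [LinearMap.range_comp_of_range_eq_top _ e.range, Submodule.range_subtype,
        LinearEquiv.ker_comp, LinearMap.ker_rangeRestrict, hf]
    · obtain ⟨ψ, hψ⟩ := hext Q _ _ hQ (φ ∘ₗ e.symm ∘ₗ f.rangeRestrict) <| by
        ext x
        have : f.rangeRestrict (f x) = 0 := Subtype.ext (hf.le ⟨x, rfl⟩)
        simp [this]
      refine ⟨ψ, LinearMap.ext fun n ↦ ?_⟩
      obtain ⟨x, rfl⟩ := (e.symm.surjective.comp f.surjective_rangeRestrict) n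
      exact (congrArg ψ (hιπ x)).trans (LinearMap.congr_fun hψ x)
  · rintro ⟨P, _, _, ι, π, hP, ⟨hι, hπ, hιπ⟩, hext⟩
    have hrange : LinearMap.range (ι ∘ₗ π) = LinearMap.range ι :=
      LinearMap.range_comp_of_range_eq_top _ (LinearMap.range_eq_top.2 hπ)
    refine ⟨P, _, _, ι ∘ₗ π, hP, ?_, ⟨?_⟩, fun Q _ _ hQ g hg ↦ ?_⟩
    · rw [hrange, hιπ, LinearMap.ker_comp_of_ker_eq_bot _ (LinearMap.ker_eq_bot.2 hι)]
    · exact (LinearEquiv.ofInjective ι hι).trans (LinearEquiv.ofEq _ _ hrange.symm)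
    · have hker : LinearMap.ker π ≤ LinearMap.ker g := by
        rw [← hιπ, ← hrange]
        exact LinearMap.range_le_ker_iff.2 hg
      obtain ⟨φ, hφ⟩ : ∃ φ : N →ₗ[R] Q, φ ∘ₗ π = g :=
        ⟨(LinearMap.ker π).liftQ g hker ∘ₗ (π.quotKerEquivOfSurjective hπ).symm, by
          ext x
          have : (π.quotKerEquivOfSurjective hπ).symm (π x) = (LinearMap.ker π).mkQ x := by
            rw [LinearEquiv.symm_apply_eq]
            rfl
          simp [this]⟩
      obtain ⟨ψ, hψ⟩ := hext Q _ _ hQ φ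
      exact ⟨ψ, by rw [← LinearMap.comp_assoc, hψ, hφ]⟩

/-- A self-extension of a syzygy `N` of `M` by a projective module, together with an extension of
the inclusion of `N`, induces a self-extension of `M` by a module of projective dimension at most
one. -/
lemma IsShortExact.exists_projDimLE_of_syzygy {N P M T : Type u} [AddCommGroup N] [Module R N]
    [AddCommGroup P] [Module R P] [AddCommGroup M] [Module R M] [AddCommGroup T] [Module R T]
    [Module.Projective R P] [Module.Projective R T] {i : N →ₗ[R] P} {p : P →ₗ[R] M}
    (hM : IsShortExact R i p) {ι : N →ₗ[R] T} {π : T →ₗ[R] N} (hN : IsShortExact R ι π)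
    (a : T →ₗ[R] P) (ha : a ∘ₗ ι = i) :
    ∃ (Q : Type u) (_ : AddCommGroup Q) (_ : Module R Q) (j : M →ₗ[R] Q) (q : Q →ₗ[R] M),
      IsShortExact R j q ∧ ProjDimLE R Q 1 := by
  obtain ⟨hi, hp, hip⟩ := hM
  obtain ⟨hι, hπ, hιπ⟩ := hN
  have ha' (n : N) : a (ι n) = i n := LinearMap.congr_fun ha n
  have hπι (n : N) : π (ι n) = 0 := hιπ.le ⟨n, rfl⟩
  have hpi (n : N) : p (i n) = 0 := hip.le ⟨n, rfl⟩
  let c : T →ₗ[R] P × P := a.prod (i ∘ₗ π)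
  have hc : Function.Injective c := by
    refine (injective_iff_map_eq_zero c).2 fun t ht ↦ ?_
    obtain ⟨h1, h2⟩ : a t = 0 ∧ i (π t) = 0 := Prod.ext_iff.1 ht
    obtain ⟨n, rfl⟩ := hιπ.ge ((map_eq_zero_iff i hi).1 h2)
    rw [ha'] at h1
    rw [(map_eq_zero_iff i hi).1 h1, map_zero]
  let j₀ : P →ₗ[R] (P × P) ⧸ LinearMap.range c := (LinearMap.range c).mkQ ∘ₗ LinearMap.inl R P P
  have hj₀ : LinearMap.ker p = LinearMap.ker j₀ := by
    ext x
    rw [← hip, LinearMap.mem_ker]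
    change _ ↔ (LinearMap.range c).mkQ (x, 0) = 0
    rw [Submodule.mkQ_apply, Submodule.Quotient.mk_eq_zero]
    constructor
    · rintro ⟨n, rfl⟩
      exact ⟨ι n, Prod.ext (ha' n) (by simp [c, hπι])⟩
    · rintro ⟨t, ht⟩
      obtain ⟨h1, h2⟩ : a t = x ∧ i (π t) = 0 := Prod.ext_iff.1 ht
      obtain ⟨n, rfl⟩ := hιπ.ge ((map_eq_zero_iff i hi).1 h2)
      exact ⟨n, by rw [← h1, ha']⟩
  let j : M →ₗ[R] (P × P) ⧸ LinearMap.range c :=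
    (LinearMap.ker p).liftQ j₀ hj₀.le ∘ₗ (p.quotKerEquivOfSurjective hp).symm
  have hj (x : P) : j (p x) = j₀ x := by
    have : (p.quotKerEquivOfSurjective hp).symm (p x) = (LinearMap.ker p).mkQ x := by
      rw [LinearEquiv.symm_apply_eq]
      rfl
    simp [j, this]
  let q : (P × P) ⧸ LinearMap.range c →ₗ[R] M :=
    (LinearMap.range c).liftQ (p ∘ₗ LinearMap.snd R P P) <| by
      rintro _ ⟨t, rfl⟩
      exact hpi (π t)
  refine ⟨_, _, _, j, q, ⟨?_, ?_, ?_⟩, (isShortExact_range_mkQ hc).projDimLE_one⟩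
  · refine (injective_iff_map_eq_zero j).2 fun m hm ↦ ?_
    obtain ⟨x, rfl⟩ := hp m
    rw [hj] at hm
    exact hj₀.ge hm
  · intro m
    obtain ⟨x, rfl⟩ := hp m
    exact ⟨(LinearMap.range c).mkQ (0, x), rfl⟩
  · ext y
    obtain ⟨⟨x₁, x₂⟩, rfl⟩ := Submodule.mkQ_surjective _ y
    constructor
    · rintro ⟨m, hm⟩
      obtain ⟨x, rfl⟩ := hp m
      rw [← hm, hj]
      exact map_zero p
    · intro (hx : p x₂ = 0)
      obtain ⟨n, rfl⟩ := hip.ge hx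
      obtain ⟨t, rfl⟩ := hπ n
      refine ⟨p (x₁ - a t), ?_⟩
      rw [hj]
      refine (Submodule.Quotient.eq _).2 ⟨-t, ?_⟩
      simp [c]

lemma IsSGHereditaryRing.exists_projDimLE_and_ext (hR : IsSGHereditaryRing R) (M : Type u)
    [AddCommGroup M] [Module R M] :
    (∃ (Q : Type u) (_ : AddCommGroup Q) (_ : Module R Q)
      (ι : M →ₗ[R] Q) (π : Q →ₗ[R] M), IsShortExact R ι π ∧ ProjDimLE R Q 1) ∧
    (∀ (P : Type u) (_ : AddCommGroup P) (_ : Module R P), Module.Projective R P →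
      ExtVanishes R M P 2) := by
  have hM := isShortExact_ker_subtype (Finsupp.linearCombination_id_surjective R M)
  obtain ⟨T, _, _, ι, π, hT, hN, hext⟩ := (isStronglyGorensteinProjective_iff _).1
    (hR (M →₀ R) _ _ inferInstance (LinearMap.ker (Finsupp.linearCombination R (id : M → M))))
  constructor
  · obtain ⟨a, ha⟩ := hext (M →₀ R) _ _ inferInstance (Submodule.subtype _)
    exact hM.exists_projDimLE_of_syzygy hN a ha
  · intro P _ _ hP
    rw [extVanishes_succ_iff]
    have := hN.subsingleton_ext_one (hext P _ _ hP)
    have := (IsProjective.iff_projective (R := R) (M →₀ R)).1 inferInstance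
    refine subsingleton_of_forall_eq 0 fun e ↦ ?_
    obtain ⟨x, rfl⟩ := Abelian.Ext.contravariant_sequence_exact₃ hM.shortExact_s2 (ModuleCat.of R P) e
      (Abelian.Ext.eq_zero_of_projective (P := ModuleCat.of R (M →₀ R)) _) (n₀ := 1) rfl
    rw [Subsingleton.elim (α := Abelian.Ext (ModuleCat.of R (LinearMap.ker
      (Finsupp.linearCombination R (id : M → M)))) (ModuleCat.of R P) 1) x 0, Abelian.Ext.comp_zero]

lemma isStronglyGorensteinProjective_of_submodule
    (hR : ∀ (P : Type u) (_ : AddCommGroup P) (_ : Module R P), Module.Projective R P →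
      HasInjectiveDimensionLT (ModuleCat.of R P) 2)
    {P : Type u} [AddCommGroup P] [Module R P] [Module.Projective R P] (N : Submodule R P)
    {Q : Type u} [AddCommGroup Q] [Module R Q] {ι : N →ₗ[R] Q} {π : Q →ₗ[R] N}
    (h : IsShortExact R ι π) (hQ : ProjDimLE R Q 1) : IsStronglyGorensteinProjective R N := by
  have hext (T : Type u) [AddCommGroup T] [Module R T] (hT : Module.Projective R T) :
      Subsingleton (Abelian.Ext (ModuleCat.of R N) (ModuleCat.of R T) 1) := by
    have := (IsProjective.iff_projective P).1 ‹Module.Projective R P›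
    have := HasProjectiveDimensionLT.subsingleton (ModuleCat.of R P) 1 1 le_rfl (ModuleCat.of R T)
    have hT' := hR T _ _ hT
    have := HasInjectiveDimensionLT.subsingleton (ModuleCat.of R T) 2 (1 + 1) le_rfl
      (ModuleCat.of R (P ⧸ LinearMap.range N.subtype))
    exact subsingleton_ext_of_shortExact_left
      (isShortExact_range_mkQ (Submodule.subtype_injective N)).shortExact_s2
  refine (isStronglyGorensteinProjective_iff N).2 ⟨Q, _, _, ι, π, ?_, h, fun T _ _ hT φ ↦ ?_⟩
  · refine projective_of_subsingleton_ext_one hQ.hasProjectiveDimensionLT fun T _ _ hT ↦ ?_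
    have := hext T hT
    exact subsingleton_ext_of_shortExact_middle h.shortExact_s2
  · have := hext T hT
    exact h.exists_extension φ

lemma hasInjectiveDimensionLT_two_of_forall_exists
    (h : ∀ (M : Type u) (_ : AddCommGroup M) (_ : Module R M),
      (∃ (Q : Type u) (_ : AddCommGroup Q) (_ : Module R Q)
        (ι : M →ₗ[R] Q) (π : Q →ₗ[R] M), IsShortExact R ι π ∧ ProjDimLE R Q 1) ∧
      (∀ (P : Type u) (_ : AddCommGroup P) (_ : Module R P), Module.Projective R P →
        ∃ i : ℕ, 1 < i ∧ ExtVanishes R M P i))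
    {P : Type u} [AddCommGroup P] [Module R P] (hP : Module.Projective R P) :
    HasInjectiveDimensionLT (ModuleCat.of R P) 2 := by
  refine hasInjectiveDimensionLT_of_enoughProjectives _ 2 fun M ↦ ?_
  obtain ⟨⟨Q, _, _, ι, π, hQ, hpd⟩, hext⟩ := h M _ _
  obtain ⟨i, hi, hv⟩ := hext P _ _ hP
  obtain ⟨n, rfl⟩ := Nat.exists_eq_add_of_le' (show 2 ≤ i from hi)
  exact hQ.subsingleton_ext_two_of_projDimLE hpd n ((extVanishes_succ_iff _ _ _).1 hv)

lemma hasProjectiveDimensionLT_two_of_forall_exists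
    (h : ∀ (M : Type u) (_ : AddCommGroup M) (_ : Module R M),
      (∃ (E : Type u) (_ : AddCommGroup E) (_ : Module R E)
        (ι : M →ₗ[R] E) (π : E →ₗ[R] M), IsShortExact R ι π ∧ InjDimLE R E 1) ∧
      (∀ (I : Type u) (_ : AddCommGroup I) (_ : Module R I), Module.Injective R I →
        ∃ i : ℕ, 1 < i ∧ ExtVanishes R I M i))
    {I : Type u} [AddCommGroup I] [Module R I] (hI : Module.Injective R I) :
    HasProjectiveDimensionLT (ModuleCat.of R I) 2 := by
  refine hasProjectiveDimensionLT_of_enoughInjectives _ 2 fun M ↦ ?_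
  obtain ⟨⟨E, _, _, ι, π, hE, hid⟩, hext⟩ := h M _ _
  obtain ⟨i, hi, hv⟩ := hext I _ _ hI
  obtain ⟨n, rfl⟩ := Nat.exists_eq_add_of_le' (show 2 ≤ i from hi)
  exact hE.subsingleton_ext_two_of_injDimLE hid n ((extVanishes_succ_iff _ _ _).1 hv)

end

/-- Theorem 2.4: characterization of strongly Gorenstein hereditary rings. -/
theorem statement_2 (R : Type u) [CommRing R] :
    List.TFAE
      [ IsSGHereditaryRing R,
        ∀ (M : Type u) (_ : AddCommGroup M) (_ : Module R M),
          (∃ (Q : Type u) (_ : AddCommGroup Q) (_ : Module R Q)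
            (ι : M →ₗ[R] Q) (π : Q →ₗ[R] M), IsShortExact R ι π ∧ ProjDimLE R Q 1) ∧
          (∀ (P : Type u) (_ : AddCommGroup P) (_ : Module R P), Module.Projective R P →
            ∃ i : ℕ, 1 < i ∧ ExtVanishes R M P i),
        ∀ (M : Type u) (_ : AddCommGroup M) (_ : Module R M),
          (∃ (E : Type u) (_ : AddCommGroup E) (_ : Module R E)
            (ι : M →ₗ[R] E) (π : E →ₗ[R] M), IsShortExact R ι π ∧ InjDimLE R E 1) ∧
          (∀ (I : Type u) (_ : AddCommGroup I) (_ : Module R I), Module.Injective R I →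
            ∃ i : ℕ, 1 < i ∧ ExtVanishes R I M i) ] := by
  tfae_have 1 → 2 := fun h M _ _ ↦
    ⟨(h.exists_projDimLE_and_ext M).1, fun P _ _ hP ↦
      ⟨2, one_lt_two, (h.exists_projDimLE_and_ext M).2 P _ _ hP⟩⟩
  tfae_have 2 → 1 := by
    intro h P _ _ hP N
    obtain ⟨⟨Q, _, _, ι, π, hQ, hpd⟩, -⟩ := h N _ _
    refine isStronglyGorensteinProjective_of_submodule (fun T _ _ hT ↦ ?_) N hQ hpd
    exact hasInjectiveDimensionLT_two_of_forall_exists h hT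
  tfae_have 2 → 3 := by
    intro h M _ _
    have hP (P : Type u) [AddCommGroup P] [Module R P] (hP : Module.Projective R P) :=
      hasInjectiveDimensionLT_two_of_forall_exists h hP
    refine ⟨?_, fun I _ _ hI ↦ ⟨2, one_lt_two, ?_⟩⟩
    · obtain ⟨⟨Q, _, _, ι, π, hQ, hpd⟩, -⟩ := h M _ _
      exact ⟨Q, _, _, ι, π, hQ, hpd.injDimLE_one fun P _ _ ↦ hP P⟩
    · obtain ⟨⟨Q, _, _, ι, π, hQ, hpd⟩, -⟩ := h I _ _
      have := hpd.hasProjectiveDimensionLT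
      have := hQ.hasProjectiveDimensionLT_left 2
      exact (extVanishes_succ_iff I M 1).2
        (CategoryTheory.HasProjectiveDimensionLT.subsingleton _ 2 2 le_rfl _)
  tfae_have 3 → 2 := by
    intro h M _ _
    have hI (I : Type u) [AddCommGroup I] [Module R I] (hI : Module.Injective R I) :=
      hasProjectiveDimensionLT_two_of_forall_exists h hI
    refine ⟨?_, fun P _ _ hP ↦ ⟨2, one_lt_two, ?_⟩⟩
    · obtain ⟨⟨E, _, _, ι, π, hE, hid⟩, -⟩ := h M _ _
      exact ⟨E, _, _, ι, π, hE, hid.projDimLE_one fun I _ _ ↦ hI I⟩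
    · obtain ⟨⟨E, _, _, ι, π, hE, hid⟩, -⟩ := h P _ _
      have := hid.hasInjectiveDimensionLT
      have := hE.hasInjectiveDimensionLT_right 2
      exact (extVanishes_succ_iff M P 1).2
        (CategoryTheory.HasInjectiveDimensionLT.subsingleton _ 2 2 le_rfl _)
  tfae_finish
end
end
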